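/- Let M_1, M'_1 ⊂ ℂ^{N_1} be generic real-analytic submanifolds through 0 of the same dimension, and assume M'_1 is l-nondegenerate at 0. Let M := M_1 × ℂ^{N_2} and M' := M'_1 × ℂ^{N_2}, both contained in ℂ^N = ℂ^{N_1} × ℂ^{N_2}, and let H be a k-equivalence between (M,0) and (M',0) with k > l + 1. Write Z = (Z^1,Z^2) and H = (H^1,H^2) according to the decomposition ℂ^{N_1} × ℂ^{N_2}. Then: (i) (∂H^1/∂Z^2)(Z) = O(|Z|^{k−l−1}); (ii) Z^1 ↦ H^1(Z^1,0) is a k-equivalence between (M_1,0) and (M'_1,0). -/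

import Mathlib

open scoped BigOperators
open Complex

noncomputable section

abbrev Cn (N : ℕ) : Type := Fin N → ℂ
abbrev Rn (m : ℕ) : Type := Fin m → ℝ

/-- A local defining function for `M` near `p`. -/
def IsDefiningFun (N d : ℕ) (M : Set (Cn N)) (p : Cn N)
    (U : Set (Cn N)) (ρ : Cn N → Rn d) : Prop :=
  IsOpen U ∧ p ∈ U ∧ AnalyticOnNhd ℝ ρ U ∧
  (∀ z ∈ U, (z ∈ M ↔ ρ z = 0)) ∧
  ∀ z ∈ U, Function.Surjective (fderiv ℝ ρ z)

/-- `M` is a real-analytic submanifold of `ℂ^N` of (real) codimension `d`. -/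
def IsRASubmanifold (N d : ℕ) (M : Set (Cn N)) : Prop :=
  ∀ p ∈ M, ∃ U ρ, IsDefiningFun N d M p U ρ

/-- A real-analytic local parametrization of `M` (of codimension `d`) at `p`. -/
def IsLocalParam (N d : ℕ) (M : Set (Cn N)) (p : Cn N)
    (Ω : Set (Rn (2*N - d))) (Z : Rn (2*N - d) → Cn N) : Prop :=
  IsOpen Ω ∧ (0 : Rn (2*N-d)) ∈ Ω ∧ Z 0 = p ∧ AnalyticOnNhd ℝ Z Ω ∧
  Set.InjOn Z Ω ∧ (∀ x ∈ Ω, Function.Injective (fderiv ℝ Z x)) ∧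
  ∃ U : Set (Cn N), IsOpen U ∧ p ∈ U ∧ Z '' Ω = M ∩ U

/-- `H` is a `k`-equivalence between `(M,p)` and `(M',p')`. -/
def IsKEquivalence (N d : ℕ) (M M' : Set (Cn N)) (p p' : Cn N) (k : ℕ)
    (H : Cn N → Cn N) : Prop :=
  AnalyticAt ℂ H p ∧ H p = p' ∧ Function.Bijective (fderiv ℂ H p) ∧
  ∃ Ω Z, IsLocalParam N d M p Ω Z ∧
    ∀ U' ρ', IsDefiningFun N d M' p' U' ρ' →
      ∃ C ε : ℝ, 0 < ε ∧ ∀ x : Rn (2*N - d), ‖x‖ < ε →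
        ‖ρ' (H (Z x))‖ ≤ C * ‖x‖ ^ k

/-- `H` is a biholomorphic equivalence between `(M,p)` and `(M',p')`. -/
def IsBiholEquivalence (N : ℕ) (M M' : Set (Cn N)) (p p' : Cn N)
    (H : Cn N → Cn N) : Prop :=
  ∃ (U U' : Set (Cn N)) (Hinv : Cn N → Cn N),
    IsOpen U ∧ IsOpen U' ∧ p ∈ U ∧ p' ∈ U' ∧ H p = p' ∧
    AnalyticOnNhd ℂ H U ∧ AnalyticOnNhd ℂ Hinv U' ∧
    Set.BijOn H U U' ∧ (∀ z ∈ U, Hinv (H z) = z) ∧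
    H '' (M ∩ U) = M' ∩ U'

/-- `V` is a real-analytic subvariety of `M`: closed in `M` and locally the common zero
set of finitely many real-valued real-analytic functions. -/
def IsRASubvarietyOf (N : ℕ) (M V : Set (Cn N)) : Prop :=
  V ⊆ M ∧ (∃ C : Set (Cn N), IsClosed C ∧ V = M ∩ C) ∧
  ∀ p ∈ M, ∃ (U : Set (Cn N)) (m : ℕ) (f : Fin m → (Cn N → ℝ)),
    IsOpen U ∧ p ∈ U ∧ (∀ i, AnalyticOnNhd ℝ (f i) U) ∧
    V ∩ U = {z ∈ M ∩ U | ∀ i, f i z = 0}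

/-- The Wirtinger derivative `∂g/∂Z_i` (with respect to the underlying real structure)
of a complex-valued function at `z`. -/
def wirtD (N : ℕ) (g : Cn N → ℂ) (z : Cn N) (i : Fin N) : ℂ :=
  (1/2) * (fderiv ℝ g z (Pi.single i 1) - Complex.I * fderiv ℝ g z (Pi.single i Complex.I))

/-- The conjugate Wirtinger derivative `∂g/∂Z̄_i` of a complex-valued function at `z`. -/
def wirtDbar (N : ℕ) (g : Cn N → ℂ) (z : Cn N) (i : Fin N) : ℂ :=
  (1/2) * (fderiv ℝ g z (Pi.single i 1) + Complex.I * fderiv ℝ g z (Pi.single i Complex.I))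

/-- The complex gradient `ρ^j_Z(p,p̄)` of a real-valued component of a defining function. -/
def cxGrad (N : ℕ) (f : Cn N → ℝ) (p : Cn N) : Cn N :=
  fun i => wirtD N (fun z => (f z : ℂ)) p i

/-- The span of all complex gradients of components of local defining functions of `M` at `p`. -/
def gradSpace (N d : ℕ) (M : Set (Cn N)) (p : Cn N) : Submodule ℂ (Cn N) :=
  Submodule.span ℂ {v : Cn N | ∃ (U : Set (Cn N)) (ρ : Cn N → Rn d) (j : Fin d),
    IsDefiningFun N d M p U ρ ∧ v = cxGrad N (fun z => ρ z j) p}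

/-- The excess codimension `r₁(p)` of `M` at `p`. -/
def excessCodim (N d : ℕ) (M : Set (Cn N)) (p : Cn N) : ℕ :=
  d - Module.finrank ℂ (gradSpace N d M p)

/-- `M` is CR at `p` if the excess codimension is constant near `p` in `M`. -/
def IsCRAt (N d : ℕ) (M : Set (Cn N)) (p : Cn N) : Prop :=
  ∃ U : Set (Cn N), IsOpen U ∧ p ∈ U ∧
    ∀ q ∈ M ∩ U, excessCodim N d M q = excessCodim N d M p

/-- `a` (given on the open ambient neighborhood `W` of `p`) is (the coefficient vector of) a
germ at `p` of a `(0,1)` vector field `L = Σ aⱼ ∂/∂Z̄ⱼ` on `M`: it is real-analytic and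
annihilates every local defining function of `M` at points of `M`. -/
def IsCR01At (N d : ℕ) (M : Set (Cn N)) (p : Cn N) (W : Set (Cn N))
    (a : Cn N → Cn N) : Prop :=
  IsOpen W ∧ p ∈ W ∧ AnalyticOnNhd ℝ a W ∧
  ∀ (q : Cn N) (U : Set (Cn N)) (ρ : Cn N → Rn d), q ∈ M → IsDefiningFun N d M q U ρ →
    ∀ z ∈ M ∩ W ∩ U, ∀ j : Fin d,
      (∑ i, a z i * wirtDbar N (fun y => ((ρ y j : ℝ) : ℂ)) z i) = 0

/-- Application of the `(0,1)` vector field with coefficients `a` to a function `g`. -/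
def applyL (N : ℕ) (a : Cn N → Cn N) (g : Cn N → ℂ) : Cn N → ℂ :=
  fun z => ∑ i, a z i * wirtDbar N g z i

/-- Iterated application `L₁ ⋯ L_s g` of `(0,1)` vector fields. -/
def iterL (N : ℕ) : List (Cn N → Cn N) → (Cn N → ℂ) → (Cn N → ℂ)
  | [], g => g
  | a :: ls, g => applyL N a (iterL N ls g)

/-- The space `E_l(p)` spanned by `(𝓛₁⋯𝓛_s ρ^j_Z)(p,p̄)` for `s ≤ l`; `Espace` with no
bound is obtained by taking `l` arbitrary. -/
def EspaceUpTo (N d : ℕ) (M : Set (Cn N)) (p : Cn N) (l : ℕ) : Submodule ℂ (Cn N) :=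
  Submodule.span ℂ {v : Cn N | ∃ (U : Set (Cn N)) (ρ : Cn N → Rn d) (j : Fin d)
    (ls : List (Cn N → Cn N)), ls.length ≤ l ∧ IsDefiningFun N d M p U ρ ∧
    (∀ a ∈ ls, ∃ W, IsCR01At N d M p W a) ∧
    v = fun i => iterL N ls (fun z => wirtD N (fun y => ((ρ y j : ℝ) : ℂ)) z i) p}

/-- The space `E(p)`. -/
def Espace (N d : ℕ) (M : Set (Cn N)) (p : Cn N) : Submodule ℂ (Cn N) :=
  Submodule.span ℂ {v : Cn N | ∃ (U : Set (Cn N)) (ρ : Cn N → Rn d) (j : Fin d)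
    (ls : List (Cn N → Cn N)), IsDefiningFun N d M p U ρ ∧
    (∀ a ∈ ls, ∃ W, IsCR01At N d M p W a) ∧
    v = fun i => iterL N ls (fun z => wirtD N (fun y => ((ρ y j : ℝ) : ℂ)) z i) p}

/-- The degeneracy `r₂(p) = N - dim E(p)` of `M` at `p`. -/
def degeneracy (N d : ℕ) (M : Set (Cn N)) (p : Cn N) : ℕ :=
  N - Module.finrank ℂ (Espace N d M p)

/-- `M` is of minimum degeneracy at `p`. -/
def IsMinDegeneracyAt (N d : ℕ) (M : Set (Cn N)) (p : Cn N) : Prop :=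
  ∃ U : Set (Cn N), IsOpen U ∧ p ∈ U ∧
    ∀ q ∈ M ∩ U, degeneracy N d M p ≤ degeneracy N d M q

/-- `M` is finitely nondegenerate at `p`. -/
def IsFinNondegAt (N d : ℕ) (M : Set (Cn N)) (p : Cn N) : Prop :=
  Espace N d M p = ⊤

/-- A complex vector field `Σ bᵢ ∂/∂Zᵢ + Σ cᵢ ∂/∂Z̄ᵢ` on (an open set of) `ℂ^N`,
recorded by its pair of coefficient vectors. -/
abbrev CVF (N : ℕ) : Type := (Cn N → Cn N) × (Cn N → Cn N)

/-- Application of a complex vector field to a function. -/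
def applyVF (N : ℕ) (X : CVF N) (g : Cn N → ℂ) : Cn N → ℂ :=
  fun z => (∑ i, X.1 z i * wirtD N g z i) + ∑ i, X.2 z i * wirtDbar N g z i

/-- The commutator of two complex vector fields. -/
def bracketVF (N : ℕ) (X Y : CVF N) : CVF N :=
  (fun z i => applyVF N X (fun w => Y.1 w i) z - applyVF N Y (fun w => X.1 w i) z,
   fun z i => applyVF N X (fun w => Y.2 w i) z - applyVF N Y (fun w => X.2 w i) z)

/-- The vector fields generated (under iterated commutators) by germs at `p` of `(0,1)`
vector fields on `M` and their complex conjugates. -/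
inductive InGenLie (N d : ℕ) (M : Set (Cn N)) (p : Cn N) : CVF N → Prop
  | of01 (W : Set (Cn N)) (a : Cn N → Cn N) (h : IsCR01At N d M p W a) :
      InGenLie N d M p (fun _ _ => 0, a)
  | conj01 (W : Set (Cn N)) (a : Cn N → Cn N) (h : IsCR01At N d M p W a) :
      InGenLie N d M p (fun z i => (starRingEnd ℂ) (a z i), fun _ _ => 0)
  | bracket (X Y : CVF N) (hX : InGenLie N d M p X) (hY : InGenLie N d M p Y) :
      InGenLie N d M p (bracketVF N X Y)

/-- The space `𝔤_M(p)`, recorded inside `ℂ^N × ℂ^N` via the values of the coefficient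
vectors at `p` (the coordinates in the frame `∂/∂Zᵢ, ∂/∂Z̄ᵢ` of `ℂ ⊗ T_pℂ^N`). -/
def orbitSpace (N d : ℕ) (M : Set (Cn N)) (p : Cn N) : Submodule ℂ (Cn N × Cn N) :=
  Submodule.span ℂ {v : Cn N × Cn N | ∃ X : CVF N, InGenLie N d M p X ∧
    v = (X.1 p, X.2 p)}

/-- The orbit codimension `r₃(p) = dim_ℝ M - dim_ℂ 𝔤_M(p)` of `M` at `p`. -/
def orbitCodim (N d : ℕ) (M : Set (Cn N)) (p : Cn N) : ℕ :=
  (2 * N - d) - Module.finrank ℂ (orbitSpace N d M p)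

/-- `M` is of minimum orbit codimension at `p`. -/
def IsMinOrbitCodimAt (N d : ℕ) (M : Set (Cn N)) (p : Cn N) : Prop :=
  ∃ U : Set (Cn N), IsOpen U ∧ p ∈ U ∧
    ∀ q ∈ M ∩ U, orbitCodim N d M p ≤ orbitCodim N d M q

/-- `M` is a generic real-analytic submanifold of codimension `d`. -/
def IsGenericSubmanifold (N d : ℕ) (M : Set (Cn N)) : Prop :=
  IsRASubmanifold N d M ∧
  ∀ p ∈ M, ∀ (U : Set (Cn N)) (ρ : Cn N → Rn d), IsDefiningFun N d M p U ρ →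
    LinearIndependent ℂ (fun j : Fin d => cxGrad N (fun z => ρ z j) p)

/-- `M` is `l`-nondegenerate at `p`: `E_l(p) = ℂ^N` and `l` is the smallest such integer. -/
def IsLNondegAt (N d : ℕ) (M : Set (Cn N)) (p : Cn N) (l : ℕ) : Prop :=
  EspaceUpTo N d M p l = ⊤ ∧ ∀ l' : ℕ, l' < l → EspaceUpTo N d M p l' ≠ ⊤

/-- The embedding `ℂ^{N₁} ∋ Z¹ ↦ (Z¹,0) ∈ ℂ^{N₁} × ℂ^{N₂}`. -/
def emb12 (N₁ N₂ : ℕ) (z : Cn N₁) : Cn (N₁ + N₂) := Fin.append z 0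

/-- The projection onto the first factor `ℂ^{N₁}`. -/
def proj1 (N₁ N₂ : ℕ) (w : Cn (N₁ + N₂)) : Cn N₁ := fun i => w (Fin.castAdd N₂ i)

/-- The submanifold `M₁ × ℂ^{N₂} ⊂ ℂ^{N₁} × ℂ^{N₂}`. -/
def prodWithFull (N₁ N₂ : ℕ) (M₁ : Set (Cn N₁)) : Set (Cn (N₁ + N₂)) :=
  {w | proj1 N₁ N₂ w ∈ M₁}

open scoped Topology
open Asymptotics Filter

section Vanishing

variable {E F Y : Type*} [NormedAddCommGroup E] [NormedAddCommGroup F]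
  [NormedAddCommGroup Y]

theorem norm_pow_isBigO_norm_pow {m n : ℕ} (h : m ≤ n) :
    (fun x : E => ‖x‖ ^ n) =O[𝓝 0] fun x => ‖x‖ ^ m :=
  .of_bound 1 <| by
    filter_upwards [Metric.ball_mem_nhds (0 : E) one_pos] with x hx
    simpa using pow_le_pow_of_le_one (norm_nonneg x) (by simpa using! (mem_ball_zero_iff.1 hx).le) h

theorem isBigO_norm_pow_iff {f : E → F} {m : ℕ} :
    f =O[𝓝 0] (fun x : E => ‖x‖ ^ m) ↔
      ∃ C ε : ℝ, 0 < ε ∧ ∀ x : E, ‖x‖ < ε → ‖f x‖ ≤ C * ‖x‖ ^ m := by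
  simp only [isBigO_iff, Metric.eventually_nhds_iff, dist_zero_right, norm_pow, norm_norm]

variable [NormedSpace ℝ E] [NormedSpace ℝ F]

theorem HasFPowerSeriesAt.apply_eq_zero_of_isBigO {f : E → F}
    {p : FormalMultilinearSeries ℝ E F} (h : HasFPowerSeriesAt f p 0) {m : ℕ}
    (hf : f =O[𝓝 0] fun x => ‖x‖ ^ m) (n : ℕ) (hn : n < m) : ∀ y : E, (p n fun _ => y) = 0 := by
  induction n using Nat.strong_induction_on with
  | _ k hk =>
    have psum_eq : p.partialSum (k + 1) = fun y => p k fun _ => y := by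
      funext z
      refine Finset.sum_eq_single _ (fun b hb hnb => ?_) fun hn => ?_
      · have := Finset.mem_range_succ_iff.mp hb
        exact hk b (this.lt_of_ne hnb) (by omega) z
      · exact False.elim (hn (Finset.mem_range.mpr (lt_add_one k)))
    have h' := h.isBigO_sub_partialSum_pow (k + 1)
    simp only [psum_eq, zero_add] at h'
    have h2 := (hf.trans (norm_pow_isBigO_norm_pow (show k + 1 ≤ m by omega))).sub h'
    simp only [sub_sub_cancel] at h2
    exact h2.continuousMultilinearMap_apply_eq_zero

theorem AnalyticAt.isBigO_fderiv [CompleteSpace F] {f : E → F} (h : AnalyticAt ℝ f 0) {m : ℕ}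
    (hf : f =O[𝓝 0] fun x => ‖x‖ ^ m) :
    (fderiv ℝ f) =O[𝓝 0] fun x => ‖x‖ ^ (m - 1) := by
  obtain ⟨p, r, hp⟩ := h
  have hz := HasFPowerSeriesAt.apply_eq_zero_of_isBigO ⟨r, hp⟩ hf
  let q : FormalMultilinearSeries ℝ E F := fun n => if n < m then 0 else p n
  have hq : HasFPowerSeriesOnBall f q 0 r := by
    refine ⟨hp.r_le.trans ?_, hp.r_pos, fun {y} hy => ?_⟩
    · refine FormalMultilinearSeries.radius_le_of_le fun n => ?_
      by_cases hn : n < m <;> simp [q, hn]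
    · convert! hp.hasSum hy using 2 with n
      by_cases hn : n < m
      · simp [q, hn, hz n hn y]
      · simp [q, hn]
  have hd := (HasFPowerSeriesOnBall.hasFPowerSeriesAt hq.fderiv).isBigO_sub_partialSum_pow (m - 1)
  have : q.derivSeries.partialSum (m - 1) = 0 := by
    funext y
    refine Finset.sum_eq_zero fun n hn => ?_
    have hn := Finset.mem_range.1 hn
    rw [FormalMultilinearSeries.derivSeries_eq_zero]
    · rfl
    · simp [q, show n + 1 < m by omega]
  simpa [this] using hd

end Vanishing

section Linear

variable {X E F : Type*} [TopologicalSpace X]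
  [NormedAddCommGroup E] [NormedSpace ℝ E]
  [NormedAddCommGroup F] [NormedSpace ℝ F] [FiniteDimensional ℝ F]

theorem ContinuousLinearMap.exists_rightInverse_of_finiteDimensional (T : E →L[ℝ] F)
    (hT : Function.Surjective T) : ∃ S : F →L[ℝ] E, ∀ y, T (S y) = y := by
  obtain ⟨S, hS⟩ := T.toLinearMap.exists_rightInverse_of_surjective (LinearMap.range_eq_top.2 hT)
  exact ⟨LinearMap.toContinuousLinearMap S, fun y => by simpa using! LinearMap.congr_fun hS y⟩

omit [FiniteDimensional ℝ F] in
theorem eventually_norm_le_two_mul {T : X → F →L[ℝ] F} {x₀ : X} (hT : ContinuousAt T x₀)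
    (h : ∀ v, T x₀ v = v) : ∀ᶠ x in 𝓝 x₀, ∀ v, ‖v‖ ≤ 2 * ‖T x v‖ := by
  have h1 : T x₀ = ContinuousLinearMap.id ℝ F := by ext v; simp [h]
  have := hT (Metric.ball_mem_nhds _ (show (0 : ℝ) < 1 / 2 by norm_num))
  filter_upwards [this] with x hx v
  have hx : ‖T x - ContinuousLinearMap.id ℝ F‖ < 1 / 2 := by
    simpa [h1, dist_eq_norm] using! hx
  have h2 : ‖(T x - ContinuousLinearMap.id ℝ F) v‖ ≤ 1 / 2 * ‖v‖ :=
    ((T x - ContinuousLinearMap.id ℝ F).le_opNorm v).trans (by gcongr)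
  have h3 : ‖v‖ ≤ ‖T x v‖ + ‖(T x - ContinuousLinearMap.id ℝ F) v‖ := by
    have : v = T x v - (T x - ContinuousLinearMap.id ℝ F) v := by simp
    conv_lhs => rw [this]
    exact norm_sub_le _ _
  linarith

theorem eventually_exists_bounded_preimage {T : X → E →L[ℝ] F} {x₀ : X} (hT : ContinuousAt T x₀)
    (h : Function.Surjective (T x₀)) :
    ∃ C : ℝ, 0 < C ∧ ∀ᶠ x in 𝓝 x₀, ∀ v, ∃ u, T x u = v ∧ ‖u‖ ≤ C * ‖v‖ := by
  obtain ⟨S, hS⟩ := (T x₀).exists_rightInverse_of_finiteDimensional h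
  refine ⟨(‖S‖ + 1) * 2, by positivity, ?_⟩
  have hc : ContinuousAt (fun x => (T x).comp S) x₀ := hT.clm_comp continuousAt_const
  filter_upwards [eventually_norm_le_two_mul hc hS] with x hx v
  have hinj : Function.Injective ((T x).comp S).toLinearMap := by
    rw [injective_iff_map_eq_zero]
    intro a ha
    have := hx a
    rw [show ((T x).comp S) a = 0 from ha] at this
    simpa using this
  obtain ⟨w, hw⟩ := (LinearMap.injective_iff_surjective.1 hinj) v
  have hw : T x (S w) = v := hw
  refine ⟨S w, hw, (S.le_opNorm w).trans ?_⟩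
  have := hx w
  rw [show ((T x).comp S) w = v from hw] at this
  calc ‖S‖ * ‖w‖ ≤ (‖S‖ + 1) * (2 * ‖v‖) := by gcongr; linarith
    _ = _ := by ring

end Linear

section Parametrization

variable {E F G Y : Type*}
  [NormedAddCommGroup E] [NormedSpace ℝ E] [FiniteDimensional ℝ E]
  [NormedAddCommGroup F] [NormedSpace ℝ F] [FiniteDimensional ℝ F]
  [NormedAddCommGroup G] [NormedSpace ℝ G] [FiniteDimensional ℝ G]
  [NormedAddCommGroup Y] [NormedSpace ℝ Y] [CompleteSpace Y]

omit [NormedSpace ℝ E] [FiniteDimensional ℝ E] [FiniteDimensional ℝ F] [CompleteSpace Y] in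
theorem isBigO_clm_apply {T : E → F →L[ℝ] Y} {v : E → F} {a b : ℕ}
    (hT : T =O[𝓝 0] fun x => ‖x‖ ^ a) (hv : v =O[𝓝 0] fun x => ‖x‖ ^ b) :
    (fun x => T x (v x)) =O[𝓝 0] fun x => ‖x‖ ^ (a + b) :=
  (IsBigO.of_bound 1 (.of_forall fun x => by
    simpa using (T x).le_opNorm (v x))).trans ((hT.norm_left.mul hv.norm_left).congr_right
      fun x => (pow_add _ _ _).symm)

omit [NormedSpace ℝ E] [FiniteDimensional ℝ E] [FiniteDimensional ℝ F] in
theorem AnalyticAt.isBigO_one_fderiv {f : F → Y} {Z : E → F} (hf : AnalyticAt ℝ f 0)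
    (hZ : ContinuousAt Z 0) (hZ0 : Z 0 = 0) :
    (fun x => fderiv ℝ f (Z x)) =O[𝓝 0] fun x => ‖x‖ ^ 0 := by
  have h : ContinuousAt (fun x => fderiv ℝ f (Z x)) 0 :=
    ContinuousAt.comp (g := fderiv ℝ f) (by rw [hZ0]; exact hf.fderiv.continuousAt) hZ
  simpa using h.tendsto.isBigO_one ℝ

omit [FiniteDimensional ℝ E] in
theorem AnalyticAt.eventually_fderiv_comp_apply {f : F → Y} {Z : E → F} {x₀ : E}
    (hf : AnalyticAt ℝ f (Z x₀)) (hZ : AnalyticAt ℝ Z x₀) :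
    ∀ᶠ x in 𝓝 x₀, ∀ u, fderiv ℝ (fun x => f (Z x)) x u = fderiv ℝ f (Z x) (fderiv ℝ Z x u) := by
  filter_upwards [hZ.eventually_analyticAt, hZ.continuousAt.eventually hf.eventually_analyticAt]
    with x h1 h2 u
  rw [fderiv_fun_comp x h2.differentiableAt h1.differentiableAt]
  rfl

/-- A right inverse `S` of `D` complements the range of an injective `A` with `D ∘ A = 0`. -/
theorem surjective_coprod_of_rightInverse {A : E →L[ℝ] F} {D : F →L[ℝ] G} {S : G →L[ℝ] F}
    (hA : Function.Injective A) (hS : ∀ y, D (S y) = y) (hDA : ∀ x, D (A x) = 0)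
    (hdim : Module.finrank ℝ E + Module.finrank ℝ G = Module.finrank ℝ F) :
    Function.Surjective (A.coprod S) := by
  have hinj : Function.Injective (A.coprod S).toLinearMap := by
    rw [injective_iff_map_eq_zero]
    rintro ⟨u, t⟩ h
    have h : A u + S t = 0 := by simpa using! h
    have ht : t = 0 := by simpa [hDA, hS] using congrArg D h
    subst ht
    have hu : A u = A 0 := by simpa using h
    simp [hA hu]
  exact (LinearMap.injective_iff_surjective_of_finrank_eq_finrank
    (by rw [Module.finrank_prod, hdim])).1 hinj

/-- If `r ∘ Z` and `f ∘ Z` vanish to high order, then so does the derivative of `f` along any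
bounded family of vectors that is tangent to the level set of `r` to high order. -/
theorem isBigO_fderiv_of_isBigO_tangent {Z : E → F} {r : F → G} {f : F → Y} {v : E → F} {k m : ℕ}
    (hZ : AnalyticAt ℝ Z 0) (hZ0 : Z 0 = 0) (hinj : Function.Injective (fderiv ℝ Z 0))
    (hr : AnalyticAt ℝ r 0) (hsurj : Function.Surjective (fderiv ℝ r 0))
    (hdim : Module.finrank ℝ E + Module.finrank ℝ G = Module.finrank ℝ F)
    (hk : 2 ≤ k) (hrZ : (fun x => r (Z x)) =O[𝓝 0] fun x => ‖x‖ ^ k) (hm : m ≤ k)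
    (hf : AnalyticAt ℝ f 0) (hfZ : (fun x => f (Z x)) =O[𝓝 0] fun x => ‖x‖ ^ m)
    (hv : v =O[𝓝 0] fun x => ‖x‖ ^ 0)
    (hrv : (fun x => fderiv ℝ r (Z x) (v x)) =O[𝓝 0] fun x => ‖x‖ ^ (k - 1)) :
    (fun x => fderiv ℝ f (Z x) (v x)) =O[𝓝 0] fun x => ‖x‖ ^ (m - 1) := by
  have hr' : AnalyticAt ℝ r (Z 0) := by rwa [hZ0]
  have hf' : AnalyticAt ℝ f (Z 0) := by rwa [hZ0]
  have hDr := (hr'.fun_comp hZ).isBigO_fderiv hrZ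
  have hDf := (hf'.fun_comp hZ).isBigO_fderiv hfZ
  obtain ⟨S, hS⟩ := (fderiv ℝ r 0).exists_rightInverse_of_finiteDimensional hsurj
  have hDA : ∀ u, fderiv ℝ r 0 (fderiv ℝ Z 0 u) = 0 := fun u => by
    have h0 : fderiv ℝ (fun x => r (Z x)) 0 = 0 :=
      (show (fderiv ℝ fun x => r (Z x)) =O[𝓝 0] fun x => ‖x - 0‖ ^ (k - 1) by
        simpa using hDr).eq_zero_of_norm_pow (by omega)
    have := (hr'.eventually_fderiv_comp_apply hZ).self_of_nhds u
    rw [h0, hZ0] at this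
    simpa using this.symm
  obtain ⟨C, hC, hpre⟩ := eventually_exists_bounded_preimage (x₀ := (0 : E))
    (T := fun x => (fderiv ℝ Z x).coprod S)
    (by
      have := hZ.fderiv.continuousAt
      fun_prop)
    (surjective_coprod_of_rightInverse hinj hS hDA hdim)
  obtain ⟨p, hp⟩ := (hpre.mono fun x hx => hx (v x)).choice
  have hp' : ∀ᶠ x in 𝓝 0, fderiv ℝ Z x (p x).1 + S (p x).2 = v x ∧ ‖p x‖ ≤ C * ‖v x‖ := hp
  have hp1 : p =O[𝓝 0] fun x => ‖x‖ ^ 0 :=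
    (IsBigO.of_bound C (hp'.mono fun x hx => hx.2)).trans hv
  have hu : (fun x => (p x).1) =O[𝓝 0] fun x => ‖x‖ ^ 0 :=
    (IsBigO.of_bound 1 (.of_forall fun x => by simpa using norm_fst_le (p x))).trans hp1
  have ht : (fun x => (p x).2) =O[𝓝 0] fun x => ‖x‖ ^ (k - 1) := by
    have hcont : ContinuousAt (fun x => (fderiv ℝ r (Z x)).comp S) 0 :=
      (ContinuousAt.comp (g := fderiv ℝ r) hr'.fderiv.continuousAt hZ.continuousAt).clm_comp
        continuousAt_const
    have h2 := eventually_norm_le_two_mul hcont (by simpa [hZ0] using hS)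
    have h3 : (fun x => fderiv ℝ r (Z x) (S (p x).2)) =O[𝓝 0] fun x => ‖x‖ ^ (k - 1) := by
      have h4 := hrv.sub (isBigO_clm_apply hDr hu)
      refine h4.congr' ?_ .rfl
      filter_upwards [hr'.eventually_fderiv_comp_apply hZ, hp'] with x hx hpx
      rw [hx, ← hpx.1, map_add, add_sub_cancel_left]
    exact (IsBigO.of_bound 2 (h2.mono fun x hx => hx (p x).2)).trans h3
  have h5 := (isBigO_clm_apply hDf hu).add
    ((isBigO_clm_apply (hf.isBigO_one_fderiv hZ.continuousAt hZ0)
      ((S.isBigO_comp _ _).trans ht)).trans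
        (norm_pow_isBigO_norm_pow (show m - 1 ≤ 0 + (k - 1) by omega)))
  refine h5.congr' ?_ .rfl
  filter_upwards [hf'.eventually_fderiv_comp_apply hZ, hp'] with x hx hpx
  rw [hx, ← hpx.1, map_add]

omit [FiniteDimensional ℝ E] in
/-- A map with surjective strict derivative is metrically regular. -/
theorem HasStrictFDerivAt.eventually_exists_preimage_dist_le [CompleteSpace E] {f : E → F}
    {f' : E →L[ℝ] F} {x₀ : E}
    (hf : HasStrictFDerivAt f f' x₀) (hsurj : Function.Surjective f') :
    ∃ C : ℝ, 0 < C ∧ ∀ᶠ p : E × F in 𝓝 (x₀, f x₀),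
      ∃ x, f x = p.2 ∧ dist x p.1 ≤ C * dist p.2 (f p.1) := by
  obtain ⟨R, hR⟩ := f'.exists_nonlinearRightInverse_of_surjective (LinearMap.range_eq_top.2 hsurj)
  have hN : (0 : ℝ) < R.nnnorm := hR
  obtain ⟨s, hs, happ⟩ := hf.approximates_deriv_on_nhds (c := R.nnnorm⁻¹ / 2)
    (Or.inr (by positivity))
  obtain ⟨δ, hδ, hball⟩ := Metric.mem_nhds_iff.1 hs
  refine ⟨2 * R.nnnorm, by positivity, ?_⟩
  have hc : ContinuousAt (fun p : E × F => 2 * R.nnnorm * dist p.2 (f p.1)) (x₀, f x₀) := by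
    have h1 : ContinuousAt (fun p : E × F => f p.1) (x₀, f x₀) :=
      ContinuousAt.comp (g := f) hf.hasFDerivAt.continuousAt continuousAt_fst
    exact continuousAt_const.mul (continuousAt_snd.dist h1)
  have hc' := hc.eventually_lt continuousAt_const
    (show 2 * R.nnnorm * dist (f x₀) (f x₀) < δ / 2 by simpa using hδ)
  have hd : ∀ᶠ p : E × F in 𝓝 (x₀, f x₀), p.1 ∈ Metric.ball x₀ (δ / 2) :=
    continuousAt_fst.eventually (Metric.ball_mem_nhds _ (by positivity))
  filter_upwards [hc', hd] with p h1 h2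
  have hsub : Metric.closedBall p.1 (2 * R.nnnorm * dist p.2 (f p.1)) ⊆ s := by
    refine subset_trans (fun x hx => ?_) hball
    have := dist_triangle x p.1 x₀
    rw [Metric.mem_closedBall] at hx
    rw [Metric.mem_ball] at h2 ⊢
    linarith
  obtain ⟨x, hx, hfx⟩ := happ.surjOn_closedBall_of_nonlinearRightInverse R (by positivity) hsub
    (show p.2 ∈ _ by
      rw [Metric.mem_closedBall]
      push_cast
      apply le_of_eq
      field_simp
      ring)
  exact ⟨x, hfx, hx⟩

omit [CompleteSpace Y] in
/-- A function vanishing on the zero set of a submersion `ρ` is `O(ρ)`. -/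
theorem isBigO_of_eq_zero_of_submersion {ρ : F → G} {φ : F → Y} (hρ : AnalyticAt ℝ ρ 0)
    (hρ0 : ρ 0 = 0) (hsurj : Function.Surjective (fderiv ℝ ρ 0)) (hφ : AnalyticAt ℝ φ 0)
    (h : ∀ᶠ z in 𝓝 0, ρ z = 0 → φ z = 0) : φ =O[𝓝 0] ρ := by
  obtain ⟨C, hC, hreg⟩ := hρ.hasStrictFDerivAt.eventually_exists_preimage_dist_le hsurj
  obtain ⟨K, t, ht, hlip⟩ := hφ.hasStrictFDerivAt.exists_lipschitzOnWith
  obtain ⟨δ, hδ, hball⟩ := Metric.mem_nhds_iff.1 (inter_mem ht h)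
  have hcont : ContinuousAt (fun z => C * dist 0 (ρ z)) 0 := by
    have := hρ.continuousAt
    fun_prop
  have h1 := hcont.eventually_lt continuousAt_const
    (show C * dist 0 (ρ 0) < δ / 2 by simpa [hρ0] using hδ)
  have h2 : Tendsto (fun z : F => (z, (0 : G))) (𝓝 0) (𝓝 (0, ρ 0)) := by
    rw [hρ0]
    exact (by fun_prop : ContinuousAt (fun z : F => (z, (0 : G))) 0)
  refine IsBigO.of_bound (K * C) ?_
  filter_upwards [h1, h2.eventually hreg, Metric.ball_mem_nhds (0 : F) (half_pos hδ)]
    with z hz ⟨x, hx, hdist⟩ hzδ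
  have hx' : dist x 0 < δ := by
    have := dist_triangle x z 0
    rw [Metric.mem_ball] at hzδ
    have hdist : dist x z ≤ C * dist 0 (ρ z) := hdist
    linarith
  have hφx : φ x = 0 := (hball hx').2 hx
  have := hlip.dist_le_mul z (hball (Metric.ball_subset_ball (by linarith) hzδ)).1 x (hball hx').1
  rw [hφx, dist_zero_right, dist_comm] at this
  calc ‖φ z‖ ≤ K * dist x z := this
    _ ≤ K * (C * ‖ρ z‖) := by
      gcongr
      simpa using hdist
    _ = _ := by ring

omit [FiniteDimensional ℝ G] in
/-- An immersion into the zero set of a submersion, of the right dimension, covers this zero set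
near the base point, and has an inverse with linear growth. -/
theorem eventually_exists_param {Z : E → F} {ρ : F → G} [FiniteDimensional ℝ G]
    (hZ : AnalyticAt ℝ Z 0) (hZ0 : Z 0 = 0) (hinj : Function.Injective (fderiv ℝ Z 0))
    (hρ : AnalyticAt ℝ ρ 0) (hsurj : Function.Surjective (fderiv ℝ ρ 0))
    (hdim : Module.finrank ℝ E + Module.finrank ℝ G = Module.finrank ℝ F)
    (hρZ : ∀ᶠ x in 𝓝 0, ρ (Z x) = 0) :
    ∃ C : ℝ, 0 < C ∧ ∀ᶠ z in 𝓝 0, ρ z = 0 → ∃ x, Z x = z ∧ ‖x‖ ≤ C * ‖z‖ := by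
  have hρ' : AnalyticAt ℝ ρ (Z 0) := by rwa [hZ0]
  obtain ⟨S, hS⟩ := (fderiv ℝ ρ 0).exists_rightInverse_of_finiteDimensional hsurj
  have hDA : ∀ u, fderiv ℝ ρ 0 (fderiv ℝ Z 0 u) = 0 := fun u => by
    have h0 : fderiv ℝ (fun x => ρ (Z x)) 0 = 0 := by
      have : (fun x => ρ (Z x)) =ᶠ[𝓝 0] fun _ => 0 := hρZ
      rw [this.fderiv_eq]
      simp
    have := (hρ'.eventually_fderiv_comp_apply hZ).self_of_nhds u
    rw [h0, hZ0] at this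
    simpa using this.symm
  have hZd : HasStrictFDerivAt Z (fderiv ℝ Z 0) (0 : E × G).1 := hZ.hasStrictFDerivAt
  have hΨ : HasStrictFDerivAt (fun p : E × G => Z p.1 + S p.2) ((fderiv ℝ Z 0).coprod S) 0 :=
    ((hZd.comp (0 : E × G) hasStrictFDerivAt_fst).add
      (S.hasStrictFDerivAt.comp (0 : E × G) hasStrictFDerivAt_snd)).congr_fderiv (by
        ext <;> simp)
  obtain ⟨C, hC, hreg⟩ := hΨ.eventually_exists_preimage_dist_le
    (surjective_coprod_of_rightInverse hinj hS hDA hdim)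
  have hρd : HasStrictFDerivAt ρ (fderiv ℝ ρ 0) (Z (0 : E × G).1 + S (0 : E × G).2) := by
    simpa [hZ0] using hρ.hasStrictFDerivAt
  have hρΨ : HasStrictFDerivAt (fun p : E × G => ρ (Z p.1 + S p.2))
      (ContinuousLinearMap.snd ℝ E G) 0 :=
    (hρd.comp (0 : E × G) hΨ).congr_fderiv (by ext <;> simp [hDA, hS])
  obtain ⟨s, hs, happ⟩ := hρΨ.approximates_deriv_on_nhds (c := 1 / 2) (Or.inr (by positivity))
  have hs' : ∀ᶠ p : E × G in 𝓝 0, p ∈ s ∧ (p.1, (0 : G)) ∈ s ∧ ρ (Z p.1) = 0 := by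
    have h1 : Tendsto (fun p : E × G => (p.1, (0 : G))) (𝓝 0) (𝓝 0) :=
      (by fun_prop : Continuous (fun p : E × G => (p.1, (0 : G)))).tendsto' _ _ (by simp)
    have h2 : Tendsto (fun p : E × G => p.1) (𝓝 0) (𝓝 0) := continuous_fst.tendsto' _ _ (by simp)
    exact (eventually_mem_set.2 hs).and ((h1.eventually hs).and (h2.eventually hρZ))
  obtain ⟨δ, hδ, hball⟩ := Metric.eventually_nhds_iff.1 hs'
  have hT : Tendsto (fun z : F => ((0 : E × G), z)) (𝓝 0)
      (𝓝 (0, Z (0 : E × G).1 + S (0 : E × G).2)) := by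
    simp only [Prod.fst_zero, Prod.snd_zero, hZ0, map_zero, add_zero]
    exact (by fun_prop : ContinuousAt (fun z : F => ((0 : E × G), z)) 0)
  refine ⟨C, hC, ?_⟩
  filter_upwards [hT.eventually hreg, Metric.ball_mem_nhds (0 : F) (div_pos hδ hC)]
    with z ⟨p, hp, hdist⟩ hz hρz
  simp only [Prod.fst_zero, Prod.snd_zero, hZ0, map_zero, add_zero, dist_zero_right] at hp hdist
  have hpδ : dist p 0 < δ := by
    rw [dist_zero_right]
    refine hdist.trans_lt ?_
    rw [mem_ball_zero_iff, lt_div_iff₀ hC] at hz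
    linarith
  obtain ⟨hp1, hp2, hp3⟩ := hball hpδ
  have := happ p hp1 _ hp2
  simp [hp, hρz, hp3] at this
  have hp0 : p.2 = 0 := by
    have h1 : ‖p.2‖ ≤ 2⁻¹ * ‖p.2‖ := by simpa [Prod.norm_def] using this
    rw [← norm_le_zero_iff]
    linarith
  refine ⟨p.1, by simpa [hp0] using hp, (norm_fst_le p).trans hdist⟩

end Parametrization

section Holomorphic

theorem AnalyticAt.isBigO_pow_succ_of_fderiv {F Y : Type*} [NormedAddCommGroup F]
    [NormedSpace ℂ F] [NormedAddCommGroup Y] [NormedSpace ℂ Y] {h : F → Y} {m : ℕ}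
    (hh : AnalyticAt ℂ h 0) (h0 : h 0 = 0)
    (hd : fderiv ℂ h =O[𝓝 0] fun z => ‖z‖ ^ m) [CompleteSpace Y] :
    h =O[𝓝 0] fun z => ‖z‖ ^ (m + 1) := by
  obtain ⟨C, hC, hb⟩ := hd.exists_pos
  obtain ⟨δ, hδ, hball⟩ := Metric.eventually_nhds_iff.1 (hb.bound.and hh.eventually_analyticAt)
  refine IsBigO.of_bound C ?_
  filter_upwards [Metric.ball_mem_nhds (0 : F) hδ] with z hz
  have key := (convex_closedBall (0 : F) ‖z‖).norm_image_sub_le_of_norm_hasFDerivWithin_le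
    (𝕜 := ℂ) (f := h) (f' := fderiv ℂ h) (C := C * ‖z‖ ^ m) (x := 0) (y := z)
    (fun w hw => ?_) (fun w hw => ?_) (by simp) (by simp)
  · rw [h0, sub_zero, sub_zero] at key
    simpa [pow_succ, mul_assoc] using key
  · rw [mem_closedBall_zero_iff] at hw
    rw [mem_ball_zero_iff] at hz
    exact (hball (by simpa using hw.trans_lt hz)).2.differentiableAt.hasFDerivAt.hasFDerivWithinAt
  · rw [mem_closedBall_zero_iff] at hw
    rw [mem_ball_zero_iff] at hz
    refine (hball (by simpa using hw.trans_lt hz)).1.trans ?_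
    simp only [norm_pow, norm_norm]
    gcongr

/-- A holomorphic map that vanishes to order `m` along a generic parametrized submanifold vanishes
to order `m`. -/
theorem isBigO_of_isBigO_comp_generic {E : Type*} [NormedAddCommGroup E] [NormedSpace ℝ E]
    [FiniteDimensional ℝ E] {F Y : Type u} [NormedAddCommGroup F] [NormedSpace ℂ F]
    [FiniteDimensional ℂ F] [NormedAddCommGroup Y] [NormedSpace ℂ Y] [CompleteSpace Y]
    {Z : E → F} {h : F → Y} {m : ℕ}
    (hZ : AnalyticAt ℝ Z 0) (hZ0 : Z 0 = 0)
    (hgen : ∀ v, ∃ u u', fderiv ℝ Z 0 u + Complex.I • fderiv ℝ Z 0 u' = v)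
    (hh : AnalyticAt ℂ h 0) (hhZ : (fun x => h (Z x)) =O[𝓝 0] fun x => ‖x‖ ^ m) :
    h =O[𝓝 0] fun z => ‖z‖ ^ m := by
  induction m generalizing Y with
  | zero => simpa using hh.continuousAt.tendsto.isBigO_one ℝ
  | succ m ih =>
    have : FiniteDimensional ℝ F := FiniteDimensional.complexToReal F
    have : CompleteSpace F := FiniteDimensional.complete ℝ F
    obtain ⟨C, hC, hpre⟩ := eventually_exists_bounded_preimage (x₀ := (0 : E))
      (T := fun x => (fderiv ℝ Z x).coprod (Complex.I • fderiv ℝ Z x))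
      (by
        have := hZ.fderiv.continuousAt
        fun_prop) (fun v => by
        obtain ⟨u, u', h⟩ := hgen v
        exact ⟨(u, u'), by simpa using! h⟩)
    have hh' : AnalyticAt ℂ h (Z 0) := by rwa [hZ0]
    have hhr : AnalyticAt ℝ h (Z 0) := hh'.restrictScalars
    have hd := (hhr.fun_comp hZ).isBigO_fderiv hhZ
    refine hh.isBigO_pow_succ_of_fderiv ?_ (ih hh.fderiv ?_)
    · have := (show (fun x => h (Z x)) =O[𝓝 0] fun x => ‖x - 0‖ ^ (m + 1) by
        simpa using hhZ).eq_zero_of_norm_pow (by omega)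
      simpa [hZ0] using this
    · refine (IsBigO.of_bound (2 * C) ?_).trans hd
      filter_upwards [hpre, hhr.eventually_fderiv_comp_apply hZ,
        hZ.continuousAt.eventually hh'.eventually_analyticAt] with x hx hchain hhx
      refine ContinuousLinearMap.opNorm_le_bound _ (by positivity) fun v => ?_
      obtain ⟨⟨u, u'⟩, hu, hn⟩ := hx v
      have hu : fderiv ℝ Z x u + Complex.I • fderiv ℝ Z x u' = v := by simpa using! hu
      have hR : ∀ w, fderiv ℂ h (Z x) w = fderiv ℝ h (Z x) w := fun w => by
        rw [hhx.differentiableAt.fderiv_restrictScalars ℝ]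
        rfl
      rw [← hu, map_add, map_smul, hR, hR, ← hchain, ← hchain, hu]
      set D := fderiv ℝ (fun x => h (Z x)) x
      have h1 : ‖D u‖ ≤ ‖D‖ * (C * ‖v‖) :=
        (D.le_opNorm u).trans (by gcongr; exact (norm_fst_le (u, u')).trans hn)
      have h2 : ‖D u'‖ ≤ ‖D‖ * (C * ‖v‖) :=
        (D.le_opNorm u').trans (by gcongr; exact (norm_snd_le (u, u')).trans hn)
      calc ‖D u + Complex.I • D u'‖ ≤ ‖D u‖ + ‖Complex.I • D u'‖ := norm_add_le _ _
        _ = ‖D u‖ + ‖D u'‖ := by rw [norm_smul]; simp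
        _ ≤ 2 * C * ‖D‖ * ‖v‖ := by linarith

end Holomorphic

section Wirtinger

variable {n : ℕ}

theorem ContinuousLinearMap.apply_single_complex (φ : Cn n →L[ℝ] ℂ) (i : Fin n) (c : ℂ) :
    φ (Pi.single i c) = c.re * φ (Pi.single i 1) + c.im * φ (Pi.single i Complex.I) := by
  have : (Pi.single i c : Cn n) =
      c.re • (Pi.single i 1 : Cn n) + c.im • (Pi.single i Complex.I : Cn n) := by
    rw [← Pi.single_smul, ← Pi.single_smul, ← Pi.single_add]
    congr 1
    simp [Complex.re_add_im]
  rw [this, map_add, map_smul, map_smul]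
  simp

theorem ContinuousLinearMap.apply_eq_sum_complex (φ : Cn n →L[ℝ] ℂ) (v : Cn n) :
    φ v = ∑ i, ((v i).re * φ (Pi.single i 1) + (v i).im * φ (Pi.single i Complex.I)) := by
  conv_lhs => rw [← Finset.univ_sum_single v, map_sum]
  exact Finset.sum_congr rfl fun i _ => φ.apply_single_complex i (v i)

theorem sum_wirtD_mul (g : Cn n → ℂ) (z b : Cn n) :
    ∑ i, wirtD n g z i * b i =
      (1 / 2) * (fderiv ℝ g z b - Complex.I * fderiv ℝ g z (Complex.I • b)) := by
  rw [(fderiv ℝ g z).apply_eq_sum_complex b, (fderiv ℝ g z).apply_eq_sum_complex (Complex.I • b),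
    Finset.mul_sum, ← Finset.sum_sub_distrib, Finset.mul_sum]
  refine Finset.sum_congr rfl fun i _ => ?_
  simp only [wirtD, Pi.smul_apply, smul_eq_mul, Complex.mul_re, Complex.mul_im, Complex.I_re,
    Complex.I_im, zero_mul, one_mul, zero_sub, zero_add, Complex.ofReal_neg]
  conv_lhs => rw [← Complex.re_add_im (b i)]
  linear_combination (-(1 / 2) * fderiv ℝ g z (Pi.single i Complex.I) * (b i).im) * Complex.I_sq

theorem applyL_eq (a : Cn n → Cn n) (g : Cn n → ℂ) (z : Cn n) :
    applyL n a g z = (1 / 2) * (fderiv ℝ g z (star (a z)) +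
      Complex.I * fderiv ℝ g z (Complex.I • star (a z))) := by
  rw [applyL, (fderiv ℝ g z).apply_eq_sum_complex (star (a z)),
    (fderiv ℝ g z).apply_eq_sum_complex (Complex.I • star (a z)),
    Finset.mul_sum, ← Finset.sum_add_distrib, Finset.mul_sum]
  refine Finset.sum_congr rfl fun i _ => ?_
  simp only [wirtDbar, Pi.smul_apply, Pi.star_apply, smul_eq_mul, Complex.mul_re, Complex.mul_im,
    Complex.I_re, Complex.I_im, zero_mul, one_mul, zero_sub, zero_add,
    Complex.ofReal_neg, RCLike.star_def, Complex.conj_re, Complex.conj_im]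
  conv_lhs => rw [← Complex.re_add_im (a z i)]
  linear_combination ((1 / 2) * fderiv ℝ g z (Pi.single i Complex.I) * (a z i).im) * Complex.I_sq

theorem AnalyticAt.fderiv_apply_const {E F : Type*} [NormedAddCommGroup E] [NormedSpace ℝ E]
    [NormedAddCommGroup F] [NormedSpace ℝ F] [CompleteSpace F] {g : E → F} {z : E}
    (hg : AnalyticAt ℝ g z) (v : E) : AnalyticAt ℝ (fun z => fderiv ℝ g z v) z :=
  ((ContinuousLinearMap.apply ℝ F v).analyticAt _).fun_comp hg.fderiv

theorem AnalyticAt.wirtD {g : Cn n → ℂ} {z : Cn n} (hg : AnalyticAt ℝ g z) (i : Fin n) :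
    AnalyticAt ℝ (fun z => wirtD n g z i) z :=
  analyticAt_const.mul ((hg.fderiv_apply_const _).sub
    (analyticAt_const.mul (hg.fderiv_apply_const _)))

theorem AnalyticAt.wirtDbar {g : Cn n → ℂ} {z : Cn n} (hg : AnalyticAt ℝ g z) (i : Fin n) :
    AnalyticAt ℝ (fun z => wirtDbar n g z i) z :=
  analyticAt_const.mul ((hg.fderiv_apply_const _).add
    (analyticAt_const.mul (hg.fderiv_apply_const _)))

theorem AnalyticAt.applyL {a : Cn n → Cn n} {g : Cn n → ℂ} {z : Cn n} (ha : AnalyticAt ℝ a z)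
    (hg : AnalyticAt ℝ g z) : AnalyticAt ℝ (applyL n a g) z :=
  Finset.univ.analyticAt_fun_sum fun i _ =>
    (((ContinuousLinearMap.proj (R := ℝ) i).analyticAt _).fun_comp ha).mul (hg.wirtDbar i)

theorem AnalyticAt.iterL {ls : List (Cn n → Cn n)} {g : Cn n → ℂ} {z : Cn n}
    (hls : ∀ a ∈ ls, AnalyticAt ℝ a z) (hg : AnalyticAt ℝ g z) : AnalyticAt ℝ (iterL n ls g) z := by
  induction ls with
  | nil => exact hg
  | cons a ls ih =>
    exact (hls a (by simp)).applyL (ih fun b hb => hls b (by simp [hb]))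

theorem IsDefiningFun.analyticAt {d : ℕ} {M U : Set (Cn n)} {p : Cn n} {ρ : Cn n → Rn d}
    (h : IsDefiningFun n d M p U ρ) : AnalyticAt ℝ ρ p :=
  h.2.2.1 p h.2.1

theorem IsDefiningFun.surjective {d : ℕ} {M U : Set (Cn n)} {p : Cn n} {ρ : Cn n → Rn d}
    (h : IsDefiningFun n d M p U ρ) : Function.Surjective (fderiv ℝ ρ p) :=
  h.2.2.2.2 p h.2.1

theorem IsDefiningFun.eventually_mem_iff {d : ℕ} {M U : Set (Cn n)} {p : Cn n} {ρ : Cn n → Rn d}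
    (h : IsDefiningFun n d M p U ρ) : ∀ᶠ z in 𝓝 p, z ∈ M ↔ ρ z = 0 :=
  Filter.mem_of_superset (h.1.mem_nhds h.2.1) h.2.2.2.1

theorem IsDefiningFun.le_two_mul {d : ℕ} {M U : Set (Cn n)} {p : Cn n} {ρ : Cn n → Rn d}
    (h : IsDefiningFun n d M p U ρ) : d ≤ 2 * n := by
  have := LinearMap.finrank_le_finrank_of_surjective (f := (fderiv ℝ ρ p).toLinearMap) h.surjective
  simpa [Module.finrank_pi_fintype, mul_comm] using this

theorem fderiv_ofReal_apply {E : Type*} [NormedAddCommGroup E] [NormedSpace ℝ E] {d : ℕ}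
    {ρ : E → Rn d} {z : E} (h : DifferentiableAt ℝ ρ z) (j : Fin d) (v : E) :
    fderiv ℝ (fun y => ((ρ y j : ℝ) : ℂ)) z v = (fderiv ℝ ρ z v j : ℝ) := by
  have h1 := (Complex.ofRealCLM.comp (ContinuousLinearMap.proj (R := ℝ) j)).hasFDerivAt.comp z
    h.hasFDerivAt
  have h2 : HasFDerivAt (fun y => ((ρ y j : ℝ) : ℂ)) _ z := h1
  rw [h2.fderiv]
  rfl

theorem AnalyticAt.ofReal_apply {E : Type*} [NormedAddCommGroup E] [NormedSpace ℝ E] {d : ℕ}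
    {ρ : E → Rn d} {z : E} (h : AnalyticAt ℝ ρ z) (j : Fin d) :
    AnalyticAt ℝ (fun y => ((ρ y j : ℝ) : ℂ)) z :=
  ((Complex.ofRealCLM.comp
    (ContinuousLinearMap.proj (R := ℝ) (φ := fun _ : Fin d => ℝ) j)).analyticAt _).fun_comp h

theorem AnalyticAt.star_pi {a : Cn n → Cn n} {z : Cn n} (ha : AnalyticAt ℝ a z) :
    AnalyticAt ℝ (fun z => star (a z)) z :=
  (((starL' ℝ : Cn n ≃L[ℝ] Cn n) : Cn n →L[ℝ] Cn n).analyticAt _).fun_comp ha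

/-- The real vector fields underlying a CR vector field on `M` are tangent to `M`. -/
theorem IsCR01At.isBigO_fderiv {d : ℕ} {M U W : Set (Cn n)} {ρ : Cn n → Rn d} {a : Cn n → Cn n}
    (h0 : (0 : Cn n) ∈ M) (hρ : IsDefiningFun n d M 0 U ρ) (ha : IsCR01At n d M 0 W a)
    {c : ℂ} (hc : c = 1 ∨ c = Complex.I) :
    (fun z => fderiv ℝ ρ z (c • star (a z))) =O[𝓝 0] ρ := by
  obtain ⟨hWo, h0W, haW, hann⟩ := ha
  refine isBigO_of_eq_zero_of_submersion hρ.analyticAt (hρ.eventually_mem_iff.self_of_nhds.1 h0)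
    hρ.surjective ?_ ?_
  · have h1 := (haW 0 h0W).star_pi
    have h2 : AnalyticAt ℝ (fun z => c • star (a z)) 0 := analyticAt_const.fun_smul h1
    exact (ContinuousLinearMap.analyticAt_bilinear (ContinuousLinearMap.id ℝ _)
      (_, _)).comp₂ hρ.analyticAt.fderiv h2
  · filter_upwards [hWo.mem_nhds h0W, hρ.1.mem_nhds hρ.2.1] with z hzW hzU hz
    funext j
    have h1 : applyL n a (fun y => ((ρ y j : ℝ) : ℂ)) z = 0 :=
      hann 0 U ρ h0 hρ z ⟨⟨(hρ.2.2.2.1 z hzU).2 hz, hzW⟩, hzU⟩ j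
    have hd := (hρ.2.2.1 z hzU).differentiableAt
    rw [applyL_eq, fderiv_ofReal_apply hd, fderiv_ofReal_apply hd] at h1
    have hre := congrArg Complex.re h1
    have him := congrArg Complex.im h1
    simp at hre him
    rcases hc with rfl | rfl <;> simpa

end Wirtinger

section Pairing

variable {n d k : ℕ} {E V : Type*}
  [NormedAddCommGroup E] [NormedSpace ℝ E] [FiniteDimensional ℝ E]
  [NormedAddCommGroup V] [NormedSpace ℂ V] [FiniteDimensional ℂ V]
  {Z : E → V} {F : V → Cn n}

omit [FiniteDimensional ℂ V] in
theorem AnalyticAt.eventually_fderiv_real_eq {Y : Type*} [NormedAddCommGroup Y] [NormedSpace ℂ Y]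
    [CompleteSpace Y] {F : V → Y} {z : V} (hF : AnalyticAt ℂ F z) :
    ∀ᶠ w in 𝓝 z, ∀ v, fderiv ℝ F w v = fderiv ℂ F w v := by
  filter_upwards [hF.eventually_analyticAt] with w hw v
  rw [hw.differentiableAt.fderiv_restrictScalars ℝ]
  rfl

omit [FiniteDimensional ℝ E] in
/-- Chain rule at the points of a parametrized set, for a real function after a holomorphic one. -/
theorem eventually_fderiv_comp_holomorphic {Y : Type*} [NormedAddCommGroup Y] [NormedSpace ℝ Y]
    [CompleteSpace Y] {f : Cn n → Y}
    (hZ : AnalyticAt ℝ Z 0) (hZ0 : Z 0 = 0) (hF : AnalyticAt ℂ F 0) (hF0 : F 0 = 0)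
    (hf : AnalyticAt ℝ f 0) :
    ∀ᶠ x in 𝓝 0, ∀ v, fderiv ℝ (fun z => f (F z)) (Z x) v =
      fderiv ℝ f (F (Z x)) (fderiv ℂ F (Z x) v) := by
  have : FiniteDimensional ℝ V := FiniteDimensional.complexToReal V
  have : CompleteSpace V := FiniteDimensional.complete ℝ V
  have hlim : Tendsto Z (𝓝 0) (𝓝 0) := by simpa [hZ0] using hZ.continuousAt.tendsto
  have h1 := AnalyticAt.eventually_fderiv_comp_apply (f := f) (Z := F) (x₀ := (0 : V))
    (by rwa [hF0]) hF.restrictScalars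
  filter_upwards [hlim.eventually h1, hlim.eventually hF.eventually_fderiv_real_eq] with x h2 h3 v
  rw [h2, h3]

theorem isBigO_sum_wirtD_mul {r : V → Rn d} {f : Cn n → ℂ} {e : V}
    (hZ : AnalyticAt ℝ Z 0) (hZ0 : Z 0 = 0) (hinj : Function.Injective (fderiv ℝ Z 0))
    (hr : AnalyticAt ℝ r 0) (hsurj : Function.Surjective (fderiv ℝ r 0))
    (hdim : Module.finrank ℝ E + d = Module.finrank ℝ V) (hk : 2 ≤ k)
    (hrZ : (fun x => r (Z x)) =O[𝓝 0] fun x => ‖x‖ ^ k)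
    (hF : AnalyticAt ℂ F 0) (hF0 : F 0 = 0) (hf : AnalyticAt ℝ f 0)
    (hfZ : (fun x => f (F (Z x))) =O[𝓝 0] fun x => ‖x‖ ^ k)
    (he : ∀ᶠ z in 𝓝 0, ∀ c : ℂ, fderiv ℝ r z (c • e) = 0) :
    (fun x => ∑ i, wirtD n f (F (Z x)) i * fderiv ℂ F (Z x) e i) =O[𝓝 0]
      fun x => ‖x‖ ^ (k - 1) := by
  have : FiniteDimensional ℝ V := FiniteDimensional.complexToReal V
  have hlim : Tendsto Z (𝓝 0) (𝓝 0) := by simpa [hZ0] using hZ.continuousAt.tendsto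
  have hfF : AnalyticAt ℝ (fun z => f (F z)) 0 :=
    AnalyticAt.fun_comp (by rwa [hF0]) hF.restrictScalars
  have key : ∀ c : ℂ, (fun x => fderiv ℝ (fun z => f (F z)) (Z x) (c • e)) =O[𝓝 0]
      fun x => ‖x‖ ^ (k - 1) := fun c =>
    isBigO_fderiv_of_isBigO_tangent hZ hZ0 hinj hr hsurj (by simpa using hdim) hk hrZ le_rfl hfF hfZ
      (by simpa using isBigO_const_const (c • e) (one_ne_zero (α := ℝ)) (𝓝 (0 : E)))
      ((isBigO_zero (E' := Rn d) (fun x : E => ‖x‖ ^ (k - 1)) (𝓝 0)).congr'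
        ((hlim.eventually he).mono fun x hx => (hx c).symm) .rfl)
  refine (((key 1).sub ((key Complex.I).const_mul_left Complex.I)).const_mul_left (1 / 2)).congr'
    ?_ .rfl
  filter_upwards [eventually_fderiv_comp_holomorphic hZ hZ0 hF hF0 hf] with x hx
  rw [sum_wirtD_mul, hx, hx, one_smul, (fderiv ℂ F (Z x)).map_smul]

theorem isBigO_sum_applyL_mul {ρ : Cn n → Rn d} {a : Cn n → Cn n} {g : Fin n → Cn n → ℂ}
    {h : V → Cn n} {m : ℕ}
    (hZ : AnalyticAt ℝ Z 0) (hZ0 : Z 0 = 0) (hinj : Function.Injective (fderiv ℝ Z 0))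
    (hdim : Module.finrank ℝ E + d = Module.finrank ℝ V) (hk : 2 ≤ k)
    (hF : AnalyticAt ℂ F 0) (hF0 : F 0 = 0) (hFsurj : Function.Surjective (fderiv ℂ F 0))
    (hρ : AnalyticAt ℝ ρ 0) (hsurj : Function.Surjective (fderiv ℝ ρ 0))
    (hρZ : (fun x => ρ (F (Z x))) =O[𝓝 0] fun x => ‖x‖ ^ k)
    (ha : AnalyticAt ℝ a 0)
    (hta : ∀ c : ℂ, c = 1 ∨ c = Complex.I →
      (fun z => fderiv ℝ ρ z (c • star (a z))) =O[𝓝 0] ρ)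
    (hg : ∀ i, AnalyticAt ℝ (g i) 0) (hh : AnalyticAt ℂ h 0) (hm : m ≤ k)
    (hgh : (fun x => ∑ i, g i (F (Z x)) * h (Z x) i) =O[𝓝 0] fun x => ‖x‖ ^ m) :
    (fun x => ∑ i, applyL n a (g i) (F (Z x)) * h (Z x) i) =O[𝓝 0] fun x => ‖x‖ ^ (m - 1) := by
  have : FiniteDimensional ℝ V := FiniteDimensional.complexToReal V
  have : CompleteSpace V := FiniteDimensional.complete ℝ V
  have hlim : Tendsto Z (𝓝 0) (𝓝 0) := by simpa [hZ0] using hZ.continuousAt.tendsto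
  have hlimF : Tendsto (fun x => F (Z x)) (𝓝 0) (𝓝 0) := by
    have := hF.continuousAt.tendsto
    rw [hF0] at this
    exact this.comp hlim
  have hFr : AnalyticAt ℝ F 0 := hF.restrictScalars
  have hr : AnalyticAt ℝ (fun z => ρ (F z)) 0 := AnalyticAt.fun_comp (by rwa [hF0]) hFr
  have hgF : ∀ i, AnalyticAt ℝ (fun z => g i (F z)) 0 := fun i =>
    AnalyticAt.fun_comp (by rw [hF0]; exact hg i) hFr
  have hhi : ∀ i, AnalyticAt ℂ (fun z => h z i) 0 := fun i =>
    ((ContinuousLinearMap.proj (R := ℂ) (φ := fun _ : Fin n => ℂ) i).analyticAt _).fun_comp hh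
  have hchain := eventually_fderiv_comp_holomorphic hZ hZ0 hF hF0 hρ
  have hf : AnalyticAt ℝ (fun z => ∑ i, g i (F z) * h z i) 0 :=
    Finset.univ.analyticAt_fun_sum fun i _ => (hgF i).mul (hhi i).restrictScalars
  have hrsurj : Function.Surjective (fderiv ℝ (fun z => ρ (F z)) 0) := fun y => by
    obtain ⟨w, hw⟩ := hsurj y
    obtain ⟨v, hv⟩ := hFsurj w
    refine ⟨v, ?_⟩
    have := hchain.self_of_nhds v
    rw [hZ0, hF0] at this
    rw [this, hv, hw]
  obtain ⟨C, hC, hpre⟩ := eventually_exists_bounded_preimage (x₀ := (0 : E))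
    (T := fun x => (fderiv ℂ F (Z x)).restrictScalars ℝ) (by
      have h1 : ContinuousAt (fun x => fderiv ℂ F (Z x)) 0 :=
        ContinuousAt.comp (g := fderiv ℂ F) (by rw [hZ0]; exact hF.fderiv.continuousAt)
          hZ.continuousAt
      exact (ContinuousLinearMap.continuous_restrictScalars ℝ).continuousAt.comp h1)
    (by simpa [hZ0] using! hFsurj)
  obtain ⟨v, hv⟩ := (hpre.mono fun x hx => hx (star (a (F (Z x))))).choice
  have hv' : ∀ᶠ x in 𝓝 0, fderiv ℂ F (Z x) (v x) = star (a (F (Z x))) ∧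
    ‖v x‖ ≤ C * ‖star (a (F (Z x)))‖ := hv
  have hv1 : v =O[𝓝 0] fun x => ‖x‖ ^ 0 := by
    refine (IsBigO.of_bound C (hv'.mono fun x hx => hx.2)).trans ?_
    simpa using (ha.star_pi.continuousAt.tendsto.comp hlimF).isBigO_one ℝ
  have key : ∀ c : ℂ, c = 1 ∨ c = Complex.I →
      (fun x => fderiv ℝ (fun z => ∑ i, g i (F z) * h z i) (Z x) (c • v x)) =O[𝓝 0]
        fun x => ‖x‖ ^ (m - 1) := fun c hc => by
    refine isBigO_fderiv_of_isBigO_tangent hZ hZ0 hinj hr hrsurj (by simpa using hdim) hk hρZ hm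
      hf hgh (hv1.const_smul_left c) ?_
    refine ((((hta c hc).comp_tendsto hlimF).trans hρZ).trans
      (norm_pow_isBigO_norm_pow (Nat.sub_le k 1))).congr' ?_ .rfl
    filter_upwards [hchain, hv'] with x hx hvx
    rw [hx, map_smul, hvx.1]
    rfl
  refine (((key 1 (Or.inl rfl)).add ((key Complex.I (Or.inr rfl)).const_mul_left
    Complex.I)).const_mul_left (1 / 2)).congr' ?_ .rfl
  have hgchain := eventually_all.2 fun i => eventually_fderiv_comp_holomorphic hZ hZ0 hF hF0 (hg i)
  have hgd := hlim.eventually (eventually_all.2 fun i => (hgF i).eventually_analyticAt)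
  have hhd := hlim.eventually (eventually_all.2 fun i => (hhi i).eventually_analyticAt)
  have hhe := hlim.eventually (eventually_all.2 fun i => (hhi i).eventually_fderiv_real_eq)
  filter_upwards [hv', hgchain, hgd, hhd, hhe] with x hvx hgc hgx hhx hhex
  have hsum : ∀ w, fderiv ℝ (fun z => ∑ i, g i (F z) * h z i) (Z x) w =
      ∑ i, (g i (F (Z x)) * fderiv ℂ (fun z => h z i) (Z x) w +
        h (Z x) i * fderiv ℝ (g i) (F (Z x)) (fderiv ℂ F (Z x) w)) := fun w => by
    rw [fderiv_fun_sum fun i _ => (hgx i).differentiableAt.fun_mul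
      (hhx i).restrictScalars.differentiableAt, sum_apply]
    refine Finset.sum_congr rfl fun i _ => ?_
    rw [fderiv_fun_mul (hgx i).differentiableAt (hhx i).restrictScalars.differentiableAt]
    simp [hhex i, hgc i]
  rw [hsum, hsum, Finset.mul_sum, ← Finset.sum_add_distrib, Finset.mul_sum]
  refine Finset.sum_congr rfl fun i _ => ?_
  rw [applyL_eq, one_smul, (fderiv ℂ F (Z x)).map_smul, (fderiv ℂ _ (Z x)).map_smul, hvx.1,
    smul_eq_mul]
  linear_combination (1 / 2) * g i (F (Z x)) * fderiv ℂ (fun z => h z i) (Z x) (v x) *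
    Complex.I_sq

end Pairing

section Geometry

variable {n d : ℕ} {M U : Set (Cn n)} {ρ : Cn n → Rn d}

theorem mulVec_surjective_of_linearIndependent_row {K ι κ : Type*} [Field K] [Fintype ι]
    [Fintype κ] {A : Matrix ι κ K} (h : LinearIndependent K A.row) :
    Function.Surjective A.mulVec := by
  have h1 : LinearMap.range A.mulVecLin = ⊤ :=
    Submodule.eq_top_of_finrank_eq (by simpa [Matrix.rank] using h.rank_matrix)
  exact LinearMap.range_eq_top.1 h1

/-- The real tangent space of a generic submanifold spans the ambient space over `ℂ`. -/
theorem IsDefiningFun.exists_add_I_smul {p : Cn n} (h : IsDefiningFun n d M p U ρ)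
    (hgen : LinearIndependent ℂ fun j : Fin d => cxGrad n (fun z => ρ z j) p) (v : Cn n) :
    ∃ a b, fderiv ℝ ρ p a = 0 ∧ fderiv ℝ ρ p b = 0 ∧ a + Complex.I • b = v := by
  have hA : ∀ b j, (Matrix.of fun j : Fin d => cxGrad n (fun z => ρ z j) p).mulVec b j =
      (1 / 2) * ((fderiv ℝ ρ p b j : ℝ) -
        Complex.I * (fderiv ℝ ρ p (Complex.I • b) j : ℝ)) := fun b j => by
    have hd := h.analyticAt.differentiableAt
    rw [← fderiv_ofReal_apply hd, ← fderiv_ofReal_apply hd, ← sum_wirtD_mul]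
    rfl
  obtain ⟨b, hb⟩ := mulVec_surjective_of_linearIndependent_row (K := ℂ)
    (A := Matrix.of fun j : Fin d => cxGrad n (fun z => ρ z j) p) hgen
    (fun j => -(1 / 2) * Complex.I * (fderiv ℝ ρ p v j : ℝ))
  have hb' := fun j => (hA b j).symm.trans (congrFun hb j)
  refine ⟨v - Complex.I • b, b, ?_, ?_, by simp⟩
  · rw [map_sub]
    funext j
    have := congrArg Complex.im (hb' j)
    simp at this
    simp [this]
  · funext j
    have := congrArg Complex.re (hb' j)
    simpa using this

/-- A submanifold of `ℂⁿ` has local parametrizations. -/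
theorem IsDefiningFun.exists_isLocalParam (h : IsDefiningFun n d M 0 U ρ) (h0 : (0 : Cn n) ∈ M) :
    ∃ Ω Z, IsLocalParam n d M 0 Ω Z := by
  have hρ0 : ρ 0 = 0 := h.eventually_mem_iff.self_of_nhds.1 h0
  obtain ⟨S, hS⟩ := (fderiv ℝ ρ 0).exists_rightInverse_of_finiteDimensional h.surjective
  have hker : Module.finrank ℝ (fderiv ℝ ρ 0).ker = Module.finrank ℝ (Rn (2 * n - d)) := by
    have h1 := (fderiv ℝ ρ 0).toLinearMap.finrank_range_add_finrank_ker
    rw [LinearMap.range_eq_top.2 h.surjective, finrank_top] at h1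
    have h2 : d + Module.finrank ℝ (fderiv ℝ ρ 0).ker = 2 * n := by
      simpa [Module.finrank_pi_fintype, mul_comm] using h1
    simp only [Module.finrank_fin_fun]
    omega
  let e := LinearEquiv.ofFinrankEq _ _ hker
  obtain ⟨L, hL⟩ : ∃ L : Cn n →L[ℝ] Rn (2 * n - d), ∀ v, fderiv ℝ ρ 0 v = 0 → L v = 0 → v = 0 := by
    let Q : Cn n →ₗ[ℝ] (fderiv ℝ ρ 0).ker :=
      ((ContinuousLinearMap.id ℝ (Cn n) - S.comp (fderiv ℝ ρ 0)).toLinearMap).codRestrict _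
        fun v => by simp [hS]
    refine ⟨LinearMap.toContinuousLinearMap (e.toLinearMap ∘ₗ Q), fun v h1 h2 => ?_⟩
    have h3 : Q v = 0 := by simpa using h2
    simpa [Q, h1] using congrArg Subtype.val h3
  let A : Cn n →L[ℝ] Rn d × Rn (2 * n - d) := (fderiv ℝ ρ 0).prod L
  have hA : Function.Injective A.toLinearMap := by
    rw [injective_iff_map_eq_zero]
    intro v hv
    have hv' : (fderiv ℝ ρ 0 v, L v) = 0 := hv
    exact hL v (congrArg Prod.fst hv') (congrArg Prod.snd hv')
  let i : Cn n ≃L[ℝ] Rn d × Rn (2 * n - d) :=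
    (LinearMap.linearEquivOfInjective A.toLinearMap hA (by
      have := h.le_two_mul
      simp [Module.finrank_pi_fintype]
      omega)).toContinuousLinearEquiv
  have hi : (i : Cn n →L[ℝ] Rn d × Rn (2 * n - d)) = A := by
    ext v <;> rfl
  have hΦa : AnalyticAt ℝ (fun z => (ρ z, L z)) 0 := h.analyticAt.prod (L.analyticAt 0)
  have hΦd : HasStrictFDerivAt (fun z => (ρ z, L z))
      (i : Cn n →L[ℝ] Rn d × Rn (2 * n - d)) 0 := by
    rw [hi]
    exact h.analyticAt.hasStrictFDerivAt.prodMk L.hasStrictFDerivAt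
  let Φ := hΦd.toOpenPartialHomeomorph
  have hΦ : ∀ z, Φ z = (ρ z, L z) := fun z => rfl
  have h0s : (0 : Cn n) ∈ Φ.source := hΦd.mem_toOpenPartialHomeomorph_source
  have hΦ0 : Φ 0 = 0 := by rw [hΦ, hρ0, map_zero]; rfl
  have hsymm : AnalyticAt ℝ Φ.symm 0 := by
    have := Φ.analyticAt_symm' (i := i) h0s hΦa hΦd.hasFDerivAt.fderiv
    rwa [hΦ0] at this
  have hsymm0 : Φ.symm 0 = 0 := by
    have := Φ.left_inv h0s
    rwa [hΦ0] at this
  have h0t : (0 : Rn d × Rn (2 * n - d)) ∈ Φ.target := hΦ0 ▸ Φ.map_source h0s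
  have hev : ∀ᶠ y in 𝓝 (0 : Rn d × Rn (2 * n - d)),
      y ∈ Φ.target ∧ AnalyticAt ℝ Φ.symm y ∧ Φ.symm y ∈ U := by
    refine (Φ.open_target.eventually_mem h0t).and (hsymm.eventually_analyticAt.and ?_)
    exact hsymm.continuousAt.eventually_mem (by rw [hsymm0]; exact h.1.mem_nhds h.2.1)
  obtain ⟨T, hT, hTo, h0T⟩ := eventually_nhds_iff.1 hev
  have hιa : ∀ x, AnalyticAt ℝ (fun x : Rn (2 * n - d) => ((0 : Rn d), x)) x :=
    fun x => (ContinuousLinearMap.inr ℝ (Rn d) (Rn (2 * n - d))).analyticAt x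
  have hιc : Continuous (fun x : Rn (2 * n - d) => ((0 : Rn d), x)) := by fun_prop
  let Ω : Set (Rn (2 * n - d)) := (fun x => ((0 : Rn d), x)) ⁻¹' T
  let Z : Rn (2 * n - d) → Cn n := fun x => Φ.symm (0, x)
  have hΦZ : ∀ x ∈ Ω, (ρ (Z x), L (Z x)) = (0, x) := fun x hx => Φ.right_inv (hT _ hx).1
  have hLZ : ∀ x ∈ Ω, L (Z x) = x := fun x hx => congrArg Prod.snd (hΦZ x hx)
  have hρZ : ∀ x ∈ Ω, ρ (Z x) = 0 := fun x hx => congrArg Prod.fst (hΦZ x hx)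
  have hZa : ∀ x ∈ Ω, AnalyticAt ℝ Z x := fun x hx =>
    AnalyticAt.fun_comp (f := fun x : Rn (2 * n - d) => ((0 : Rn d), x)) (hT _ hx).2.1 (hιa x)
  have hΩ : IsOpen Ω := hTo.preimage hιc
  refine ⟨Ω, Z, hΩ, h0T, hsymm0, hZa, fun x hx y hy hxy => ?_, fun x hx => ?_,
    Φ.source ∩ Φ ⁻¹' T, Φ.isOpen_inter_preimage hTo, ⟨h0s, ?_⟩, ?_⟩
  · rw [← hLZ x hx, ← hLZ y hy, hxy]
  · refine Function.LeftInverse.injective (g := L) fun u => ?_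
    have h1 : (fun x => L (Z x)) =ᶠ[𝓝 x] id :=
      Filter.mem_of_superset (hΩ.mem_nhds hx) hLZ
    have h2 : HasFDerivAt (fun x => L (Z x)) (L.comp (fderiv ℝ Z x)) x :=
      L.hasFDerivAt.comp x (hZa x hx).differentiableAt.hasFDerivAt
    have h3 := h2.fderiv.symm.trans h1.fderiv_eq
    simpa using! congrArg (fun T => T u) h3
  · rw [Set.mem_preimage, hΦ0]
    exact h0T
  · ext z
    constructor
    · rintro ⟨x, hx, rfl⟩
      refine ⟨(h.2.2.2.1 _ (hT _ hx).2.2).2 (hρZ x hx), Φ.map_target (hT _ hx).1, ?_⟩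
      rw [Set.mem_preimage, hΦ, hΦZ x hx]
      exact hx
    · rintro ⟨hzM, hzs, hzT⟩
      rw [Set.mem_preimage] at hzT
      have hzU : z ∈ U := by
        have := (hT _ hzT).2.2
        rwa [Φ.left_inv hzs] at this
      have hz : Φ z = (0, L z) := by rw [hΦ, (h.2.2.2.1 z hzU).1 hzM]
      rw [hz] at hzT
      refine ⟨L z, hzT, ?_⟩
      change Φ.symm (0, L z) = z
      rw [← hz, Φ.left_inv hzs]

theorem IsLocalParam.analyticAt {Ω : Set (Rn (2 * n - d))} {Z : Rn (2 * n - d) → Cn n} {p : Cn n}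
    (hZ : IsLocalParam n d M p Ω Z) : AnalyticAt ℝ Z 0 :=
  hZ.2.2.2.1 0 hZ.2.1

theorem IsLocalParam.injective {Ω : Set (Rn (2 * n - d))} {Z : Rn (2 * n - d) → Cn n} {p : Cn n}
    (hZ : IsLocalParam n d M p Ω Z) : Function.Injective (fderiv ℝ Z 0) :=
  hZ.2.2.2.2.2.1 0 hZ.2.1

theorem IsLocalParam.eventually_eq_zero {Ω : Set (Rn (2 * n - d))} {Z : Rn (2 * n - d) → Cn n}
    {p : Cn n} (hZ : IsLocalParam n d M p Ω Z) (h : IsDefiningFun n d M p U ρ) :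
    ∀ᶠ x in 𝓝 0, ρ (Z x) = 0 := by
  obtain ⟨hΩ, h0Ω, hZ0, hZa, -, -, U', -, -, himg⟩ := hZ
  have hlim : Tendsto Z (𝓝 0) (𝓝 p) := by
    simpa [hZ0] using (hZa 0 h0Ω).continuousAt.tendsto
  filter_upwards [hΩ.mem_nhds h0Ω, hlim.eventually h.eventually_mem_iff] with x hx hx'
  have : Z x ∈ M ∩ U' := himg ▸ Set.mem_image_of_mem Z hx
  exact hx'.1 this.1

theorem IsDefiningFun.finrank_add (h : IsDefiningFun n d M 0 U ρ) :
    Module.finrank ℝ (Rn (2 * n - d)) + d = Module.finrank ℝ (Cn n) := by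
  have := h.le_two_mul
  simp [Module.finrank_pi_fintype]
  omega

theorem IsLocalParam.exists_fderiv_eq {Ω : Set (Rn (2 * n - d))} {Z : Rn (2 * n - d) → Cn n}
    (hZ : IsLocalParam n d M 0 Ω Z) (h : IsDefiningFun n d M 0 U ρ) {v : Cn n}
    (hv : fderiv ℝ ρ 0 v = 0) : ∃ u, fderiv ℝ Z 0 u = v := by
  have hZ0 : Z 0 = 0 := hZ.2.2.1
  have hDA : ∀ u, fderiv ℝ ρ 0 (fderiv ℝ Z 0 u) = 0 := fun u => by
    have h1 : (fun x => ρ (Z x)) =ᶠ[𝓝 0] fun _ => 0 := hZ.eventually_eq_zero h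
    have h2 := (AnalyticAt.eventually_fderiv_comp_apply (f := ρ)
      (by rw [hZ0]; exact h.analyticAt) hZ.analyticAt).self_of_nhds u
    rw [h1.fderiv_eq, hZ0] at h2
    simpa using h2.symm
  obtain ⟨S, hS⟩ := (fderiv ℝ ρ 0).exists_rightInverse_of_finiteDimensional h.surjective
  obtain ⟨⟨u, t⟩, hut⟩ := surjective_coprod_of_rightInverse hZ.injective hS hDA
    (by simpa using h.finrank_add) v
  have hut : fderiv ℝ Z 0 u + S t = v := by simpa using! hut
  have ht : t = 0 := by simpa [hDA, hS, hv] using congrArg (fderiv ℝ ρ 0) hut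
  exact ⟨u, by simpa [ht] using hut⟩

end Geometry

section Product

variable {N₁ N₂ d k l : ℕ} {M₁ M₁' : Set (Cn N₁)}

/-- The projection onto the first factor as a continuous linear map. -/
def proj1CLM (N₁ N₂ : ℕ) : Cn (N₁ + N₂) →L[ℂ] Cn N₁ :=
  ContinuousLinearMap.pi fun i => ContinuousLinearMap.proj (Fin.castAdd N₂ i)

theorem coe_proj1CLM : ⇑(proj1CLM N₁ N₂) = proj1 N₁ N₂ := rfl

/-- The embedding of the first factor as a continuous linear map. -/
def emb12CLM (N₁ N₂ : ℕ) : Cn N₁ →L[ℂ] Cn (N₁ + N₂) :=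
  LinearMap.toContinuousLinearMap
    { toFun := emb12 N₁ N₂
      map_add' := fun x y => by
        funext i
        refine Fin.addCases (fun i => ?_) (fun i => ?_) i <;> simp [emb12]
      map_smul' := fun c x => by
        funext i
        refine Fin.addCases (fun i => ?_) (fun i => ?_) i <;> simp [emb12] }

theorem proj1_emb12 (z : Cn N₁) : proj1 N₁ N₂ (emb12 N₁ N₂ z) = z := by
  funext i
  simp [proj1, emb12]

theorem proj1_single_natAdd (j : Fin N₂) (c : ℂ) :
    proj1 N₁ N₂ (Pi.single (Fin.natAdd N₁ j) c) = 0 := by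
  funext i
  have : Fin.castAdd N₂ i ≠ Fin.natAdd N₁ j := by
    intro h
    have := congrArg Fin.val h
    simp at this
    omega
  simp [proj1, this]

theorem eq_emb12_add_sum (w : Cn (N₁ + N₂)) :
    w = emb12 N₁ N₂ (proj1 N₁ N₂ w) +
      ∑ j : Fin N₂, w (Fin.natAdd N₁ j) • (Pi.single (Fin.natAdd N₁ j) 1 : Cn (N₁ + N₂)) := by
  funext i
  refine Fin.addCases (fun i => ?_) (fun i => ?_) i
  · have h : ∀ j, (Pi.single (Fin.natAdd N₁ j) (1 : ℂ) : Cn (N₁ + N₂)) (Fin.castAdd N₂ i) = 0 :=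
      fun j => congrFun (proj1_single_natAdd j 1) i
    simp [emb12, proj1, Finset.sum_apply, h]
  · simp [emb12, Finset.sum_apply, Pi.single_apply]

theorem fderiv_comp_proj1 {ρ : Cn N₁ → Rn d} {z : Cn (N₁ + N₂)}
    (h : DifferentiableAt ℝ ρ (proj1 N₁ N₂ z)) (v : Cn (N₁ + N₂)) :
    fderiv ℝ (fun w => ρ (proj1 N₁ N₂ w)) z v =
      fderiv ℝ ρ (proj1 N₁ N₂ z) (proj1 N₁ N₂ v) := by
  have h1 : HasFDerivAt (fun w => ρ (proj1 N₁ N₂ w)) _ z :=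
    h.hasFDerivAt.comp z ((proj1CLM N₁ N₂).restrictScalars ℝ).hasFDerivAt
  rw [h1.fderiv]
  rfl

theorem IsDefiningFun.prodWithFull {U : Set (Cn N₁)} {ρ : Cn N₁ → Rn d}
    (h : IsDefiningFun N₁ d M₁ 0 U ρ) :
    IsDefiningFun (N₁ + N₂) d (prodWithFull N₁ N₂ M₁) 0 (proj1 N₁ N₂ ⁻¹' U)
      fun w => ρ (proj1 N₁ N₂ w) := by
  obtain ⟨hU, h0, ha, hM, hs⟩ := h
  refine ⟨hU.preimage (proj1CLM N₁ N₂).continuous, h0, fun z hz => ?_, fun z hz => hM _ hz,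
    fun z hz y => ?_⟩
  · exact AnalyticAt.fun_comp (f := proj1 N₁ N₂) (ha _ hz)
      (((proj1CLM N₁ N₂).restrictScalars ℝ).analyticAt z)
  · obtain ⟨v, hv⟩ := hs _ hz y
    refine ⟨emb12 N₁ N₂ v, ?_⟩
    rw [fderiv_comp_proj1 (ha _ hz).differentiableAt, proj1_emb12, hv]

theorem isBigO_of_eSpaceUpTo_eq_top {E V : Type*} [NormedAddCommGroup E] [NormedSpace ℝ E]
    [FiniteDimensional ℝ E] [NormedAddCommGroup V] [NormedSpace ℂ V] [FiniteDimensional ℂ V]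
    {Z : E → V} {F : V → Cn N₁} {r : V → Rn d} {e : V}
    (h0' : (0 : Cn N₁) ∈ M₁') (hnd : EspaceUpTo N₁ d M₁' 0 l = ⊤) (hk : l + 1 < k)
    (hZ : AnalyticAt ℝ Z 0) (hZ0 : Z 0 = 0) (hinj : Function.Injective (fderiv ℝ Z 0))
    (hr : AnalyticAt ℝ r 0) (hsurj : Function.Surjective (fderiv ℝ r 0))
    (hdim : Module.finrank ℝ E + d = Module.finrank ℝ V)
    (hrZ : (fun x => r (Z x)) =O[𝓝 0] fun x => ‖x‖ ^ k)
    (hF : AnalyticAt ℂ F 0) (hF0 : F 0 = 0) (hFsurj : Function.Surjective (fderiv ℂ F 0))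
    (hρZ : ∀ U ρ, IsDefiningFun N₁ d M₁' 0 U ρ →
      (fun x => ρ (F (Z x))) =O[𝓝 0] fun x => ‖x‖ ^ k)
    (he : ∀ᶠ z in 𝓝 0, ∀ c : ℂ, fderiv ℝ r z (c • e) = 0) :
    (fun x => fderiv ℂ F (Z x) e) =O[𝓝 0] fun x => ‖x‖ ^ (k - l - 1) := by
  set h : V → Cn N₁ := fun z => fderiv ℂ F z e with hh_def
  have hh : AnalyticAt ℂ h 0 := ((ContinuousLinearMap.apply ℂ (Cn N₁) e).analyticAt _).fun_comp
    hF.fderiv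
  have hFZ : ContinuousAt (fun x => F (Z x)) 0 :=
    ContinuousAt.comp (g := F) (by rw [hZ0]; exact hF.continuousAt) hZ.continuousAt
  have hFZ0 : F (Z 0) = 0 := by rw [hZ0, hF0]
  have hiter : ∀ U ρ (j : Fin d), IsDefiningFun N₁ d M₁' 0 U ρ → ∀ ls : List (Cn N₁ → Cn N₁),
      (∀ a ∈ ls, ∃ W, IsCR01At N₁ d M₁' 0 W a) →
      (fun x => ∑ i, iterL N₁ ls (fun z => wirtD N₁ (fun y => ((ρ y j : ℝ) : ℂ)) z i) (F (Z x)) *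
        h (Z x) i) =O[𝓝 0] fun x => ‖x‖ ^ (k - 1 - ls.length) := by
    intro U ρ j hρ ls
    have hw : ∀ i, AnalyticAt ℝ (fun z => wirtD N₁ (fun y => ((ρ y j : ℝ) : ℂ)) z i) 0 :=
      fun i => (hρ.analyticAt.ofReal_apply j).wirtD i
    induction ls with
    | nil =>
      intro _
      refine isBigO_sum_wirtD_mul hZ hZ0 hinj hr hsurj hdim (by omega) hrZ hF hF0
        (hρ.analyticAt.ofReal_apply j) ?_ he
      exact (IsBigO.of_bound 1 (.of_forall fun x => by
        simpa using norm_le_pi_norm (ρ (F (Z x))) j)).trans (hρZ U ρ hρ)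
    | cons a ls ih =>
      intro hls
      obtain ⟨W, hW⟩ := hls a (by simp)
      have hls' : ∀ b ∈ ls, ∃ W, IsCR01At N₁ d M₁' 0 W b := fun b hb => hls b (by simp [hb])
      have := isBigO_sum_applyL_mul hZ hZ0 hinj hdim (by omega) hF hF0 hFsurj hρ.analyticAt
        hρ.surjective (hρZ U ρ hρ) (hW.2.2.1 0 hW.2.1)
        (fun c hc => hW.isBigO_fderiv h0' hρ hc)
        (fun i => AnalyticAt.iterL (fun b hb => by
          obtain ⟨W', hW'⟩ := hls' b hb
          exact hW'.2.2.1 0 hW'.2.1) (hw i))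
        hh (by omega) (ih hls')
      simpa only [List.length_cons, Nat.sub_sub, add_assoc, iterL] using this
  have hspan : ∀ v : Cn N₁, ∃ g : Cn N₁ → Cn N₁, ContinuousAt g 0 ∧ g 0 = v ∧
      (fun x => ∑ i, g (F (Z x)) i * h (Z x) i) =O[𝓝 0] fun x => ‖x‖ ^ (k - l - 1) := by
    intro v
    have hv : v ∈ EspaceUpTo N₁ d M₁' 0 l := by rw [hnd]; trivial
    induction hv using Submodule.span_induction with
    | mem v hv =>
      obtain ⟨U, ρ, j, ls, hlen, hρ, hls, rfl⟩ := hv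
      refine ⟨fun z i => iterL N₁ ls (fun z => wirtD N₁ (fun y => ((ρ y j : ℝ) : ℂ)) z i) z,
        continuousAt_pi.2 fun i => ?_, rfl,
        (hiter U ρ j hρ ls hls).trans (norm_pow_isBigO_norm_pow (by omega))⟩
      exact (AnalyticAt.iterL (fun b hb => by
        obtain ⟨W', hW'⟩ := hls b hb
        exact hW'.2.2.1 0 hW'.2.1) ((hρ.analyticAt.ofReal_apply j).wirtD i)).continuousAt
    | zero => exact ⟨fun _ => 0, continuousAt_const, rfl, by simpa using isBigO_zero _ _⟩
    | add v w _ _ ihv ihw =>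
      obtain ⟨g, hg, rfl, hgO⟩ := ihv
      obtain ⟨g', hg', rfl, hgO'⟩ := ihw
      refine ⟨fun z => g z + g' z, hg.add hg', rfl, (hgO.add hgO').congr_left fun x => ?_⟩
      simp [add_mul, Finset.sum_add_distrib]
    | smul c v _ ihv =>
      obtain ⟨g, hg, rfl, hgO⟩ := ihv
      refine ⟨fun z => c • g z, hg.const_smul c, rfl, (hgO.const_mul_left c).congr_left fun x => ?_⟩
      simp [Finset.mul_sum, mul_assoc]
  choose g hg hg0 hgO using fun b : Fin N₁ => hspan (Pi.single b 1)
  let T : E → Cn N₁ →L[ℝ] Cn N₁ := fun x => ContinuousLinearMap.pi fun b =>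
    ∑ i, g b (F (Z x)) i • ContinuousLinearMap.proj (R := ℝ) (φ := fun _ : Fin N₁ => ℂ) i
  have hT : ∀ x v b, T x v b = ∑ i, g b (F (Z x)) i * v i := fun x v b => by
    simp [T, sum_apply]
  have hTc : ContinuousAt T 0 := by
    refine continuousAt_clm_apply.2 fun v => continuousAt_pi.2 fun b => ?_
    simp only [hT]
    have h1 : ContinuousAt (fun x => g b (F (Z x))) 0 :=
      ContinuousAt.comp (g := g b) (by rw [hFZ0]; exact hg b) hFZ
    exact tendsto_finsetSum _ fun i _ => (continuousAt_pi.1 h1 i).mul continuousAt_const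
  have h1 := eventually_norm_le_two_mul hTc fun v => by
    funext b
    rw [hT, hFZ0, hg0]
    simp [Pi.single_apply]
  refine (IsBigO.of_bound 2 (h1.mono fun x hx => hx (h (Z x)))).trans (isBigO_pi.2 fun b => ?_)
  simp only [hT]
  exact hgO b

end Product

section KEquivalence

variable {N₁ N₂ d k l : ℕ} {M₁ M₁' : Set (Cn N₁)} {H : Cn (N₁ + N₂) → Cn (N₁ + N₂)}

theorem fderiv_proj1_comp {z : Cn (N₁ + N₂)} (h : DifferentiableAt ℂ H z) (v : Cn (N₁ + N₂)) :
    fderiv ℂ (fun w => proj1 N₁ N₂ (H w)) z v = proj1 N₁ N₂ (fderiv ℂ H z v) := by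
  have h1 : HasFDerivAt (fun w => proj1 N₁ N₂ (H w)) _ z :=
    (proj1CLM N₁ N₂).hasFDerivAt.comp z h.hasFDerivAt
  rw [h1.fderiv]
  rfl

theorem fderiv_apply_comp {m n : ℕ} {H : Cn m → Cn n} {z : Cn m} (h : DifferentiableAt ℂ H z)
    (i : Fin n) (v : Cn m) :
    fderiv ℂ (fun w => H w i) z v = fderiv ℂ H z v i := by
  rw [(hasFDerivAt_pi'.1 h.hasFDerivAt i).fderiv]
  rfl

theorem IsKEquivalence.isBigO_comp {n : ℕ} {M M' : Set (Cn n)} {p p' : Cn n} {H : Cn n → Cn n}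
    (hH : IsKEquivalence n d M M' p p' k H) :
    ∃ Ω Z, IsLocalParam n d M p Ω Z ∧ ∀ U' ρ', IsDefiningFun n d M' p' U' ρ' →
      (fun x => ρ' (H (Z x))) =O[𝓝 0] fun x => ‖x‖ ^ k := by
  obtain ⟨-, -, -, Ω, Z, hZ, hb⟩ := hH
  exact ⟨Ω, Z, hZ, fun U' ρ' h => isBigO_norm_pow_iff.2 (hb U' ρ' h)⟩

theorem IsKEquivalence.isBigO_fderiv_proj1
    (hH : IsKEquivalence (N₁ + N₂) d (prodWithFull N₁ N₂ M₁) (prodWithFull N₁ N₂ M₁') 0 0 k H)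
    (h₁ : IsGenericSubmanifold N₁ d M₁) (h0 : (0 : Cn N₁) ∈ M₁) (h0' : (0 : Cn N₁) ∈ M₁')
    (hnd : EspaceUpTo N₁ d M₁' 0 l = ⊤) (hk : l + 1 < k) (j : Fin N₂) :
    (fun z => fderiv ℂ (fun w => proj1 N₁ N₂ (H w)) z (Pi.single (Fin.natAdd N₁ j) 1)) =O[𝓝 0]
      fun z => ‖z‖ ^ (k - l - 1) := by
  obtain ⟨Ω, Z, hZ, hb⟩ := hH.isBigO_comp
  obtain ⟨hHa, hH0, hHb, -⟩ := hH
  obtain ⟨U, ρ, hρ⟩ := h₁.1 0 h0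
  have hr := hρ.prodWithFull (N₂ := N₂)
  have hZ0 : Z 0 = 0 := hZ.2.2.1
  have hF : AnalyticAt ℂ (fun w => proj1 N₁ N₂ (H w)) 0 :=
    ((proj1CLM N₁ N₂).analyticAt _).fun_comp hHa
  have hF0 : (fun w => proj1 N₁ N₂ (H w)) 0 = 0 := by
    change proj1 N₁ N₂ (H 0) = 0
    rw [hH0]
    rfl
  refine isBigO_of_isBigO_comp_generic
    (h := fun z => fderiv ℂ (fun w => proj1 N₁ N₂ (H w)) z (Pi.single (Fin.natAdd N₁ j) 1))
    hZ.analyticAt hZ0 (fun v => ?_) ?_ ?_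
  · obtain ⟨a, b, ha, hb, hab⟩ := hρ.exists_add_I_smul (h₁.2 0 h0 U ρ hρ) (proj1 N₁ N₂ v)
    have hd : DifferentiableAt ℝ ρ (proj1 N₁ N₂ 0) := hρ.analyticAt.differentiableAt
    obtain ⟨u', hu'⟩ := hZ.exists_fderiv_eq hr (v := emb12 N₁ N₂ b) (by
      rw [fderiv_comp_proj1 hd, proj1_emb12]
      exact hb)
    obtain ⟨u, hu⟩ := hZ.exists_fderiv_eq hr (v := v - Complex.I • emb12 N₁ N₂ b) (by
      rw [fderiv_comp_proj1 hd, ← coe_proj1CLM, map_sub, map_smul, coe_proj1CLM, proj1_emb12, ← hab,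
        add_sub_cancel_right]
      exact ha)
    exact ⟨u, u', by rw [hu, hu', sub_add_cancel]⟩
  · exact ((ContinuousLinearMap.apply ℂ (Cn N₁) _).analyticAt _).fun_comp hF.fderiv
  · refine isBigO_of_eSpaceUpTo_eq_top h0' hnd hk hZ.analyticAt hZ0 hZ.injective hr.analyticAt
      hr.surjective hr.finrank_add ?_ hF hF0 (fun y => ?_) (fun U' ρ' hρ' => ?_) ?_
    · exact (isBigO_zero _ _).congr' ((hZ.eventually_eq_zero hr).mono fun x hx => hx.symm) .rfl
    · obtain ⟨v, hv⟩ := hHb.2 (emb12 N₁ N₂ y)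
      exact ⟨v, by rw [fderiv_proj1_comp hHa.differentiableAt, hv, proj1_emb12]⟩
    · exact hb _ _ hρ'.prodWithFull
    · filter_upwards [hr.1.mem_nhds hr.2.1] with z hz c
      rw [fderiv_comp_proj1 (hρ.2.2.1 _ hz).differentiableAt, ← Pi.single_smul,
        proj1_single_natAdd, map_zero]

theorem IsKEquivalence.proj1_emb12
    (hH : IsKEquivalence (N₁ + N₂) d (prodWithFull N₁ N₂ M₁) (prodWithFull N₁ N₂ M₁') 0 0 k H)
    (h₁ : IsGenericSubmanifold N₁ d M₁) (h0 : (0 : Cn N₁) ∈ M₁)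
    (hH' : ∀ j : Fin N₂, proj1 N₁ N₂ (fderiv ℂ H 0 (Pi.single (Fin.natAdd N₁ j) 1)) = 0) :
    IsKEquivalence N₁ d M₁ M₁' 0 0 k fun z => proj1 N₁ N₂ (H (emb12 N₁ N₂ z)) := by
  obtain ⟨Ω, Z, hZ, hb⟩ := hH.isBigO_comp
  obtain ⟨hHa, hH0, hHb, -⟩ := hH
  obtain ⟨U, ρ, hρ⟩ := h₁.1 0 h0
  obtain ⟨Ω₁, Z₁, hZ₁⟩ := hρ.exists_isLocalParam h0
  have hr := hρ.prodWithFull (N₂ := N₂)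
  have hJ0 : emb12 N₁ N₂ 0 = 0 := (emb12CLM N₁ N₂).map_zero
  have hHJ : AnalyticAt ℂ (fun z => H (emb12 N₁ N₂ z)) 0 :=
    AnalyticAt.fun_comp (f := emb12 N₁ N₂) (by rwa [hJ0]) ((emb12CLM N₁ N₂).analyticAt 0)
  have hfd : ∀ v, fderiv ℂ (fun z => proj1 N₁ N₂ (H (emb12 N₁ N₂ z))) 0 v =
      proj1 N₁ N₂ (fderiv ℂ H 0 (emb12 N₁ N₂ v)) := fun v => by
    have hd : HasFDerivAt H (fderiv ℂ H 0) (emb12 N₁ N₂ 0) := by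
      rw [hJ0]
      exact hHa.differentiableAt.hasFDerivAt
    have h1 : HasFDerivAt (fun z => proj1 N₁ N₂ (H (emb12 N₁ N₂ z))) _ 0 :=
      (proj1CLM N₁ N₂).hasFDerivAt.comp 0 (hd.comp 0 (emb12CLM N₁ N₂).hasFDerivAt)
    rw [h1.fderiv]
    rfl
  have hsurj : Function.Surjective (fderiv ℂ (fun z => proj1 N₁ N₂ (H (emb12 N₁ N₂ z))) 0) := by
    intro y
    obtain ⟨w, hw⟩ := hHb.2 (emb12 N₁ N₂ y)
    refine ⟨proj1 N₁ N₂ w, ?_⟩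
    have h1 := congrArg (proj1CLM N₁ N₂) hw
    rw [eq_emb12_add_sum w, map_add, map_add, map_sum, map_sum] at h1
    simp only [map_smul, coe_proj1CLM, hH', smul_zero, Finset.sum_const_zero, add_zero,
      _root_.proj1_emb12] at h1
    rw [hfd, h1]
  refine ⟨((proj1CLM N₁ N₂).analyticAt _).fun_comp hHJ, ?_, ⟨?_, hsurj⟩, Ω₁, Z₁, hZ₁,
    fun U' ρ' hρ' => isBigO_norm_pow_iff.1 ?_⟩
  · change proj1 N₁ N₂ (H (emb12 N₁ N₂ 0)) = 0
    rw [hJ0, hH0]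
    rfl
  · exact (LinearMap.injective_iff_surjective
      (f := (fderiv ℂ (fun z => proj1 N₁ N₂ (H (emb12 N₁ N₂ z))) 0).toLinearMap)).2 hsurj
  have hO : (fun x => emb12 N₁ N₂ (Z₁ x)) =O[𝓝 0] fun x => x := by
    have h1 := hZ₁.analyticAt.differentiableAt.isBigO_sub
    simp only [show Z₁ 0 = 0 from hZ₁.2.2.1, sub_zero] at h1
    exact ((emb12CLM N₁ N₂).isBigO_comp _ _).trans h1
  obtain ⟨C, hC, hpar⟩ := eventually_exists_param hZ.analyticAt hZ.2.2.1 hZ.injective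
    hr.analyticAt hr.surjective (by simpa using hr.finrank_add) (hZ.eventually_eq_zero hr)
  have hlim : Tendsto (fun x => emb12 N₁ N₂ (Z₁ x)) (𝓝 0) (𝓝 0) :=
    hO.trans_tendsto tendsto_id
  obtain ⟨y, hy⟩ := (((hlim.eventually hpar).and (hZ₁.eventually_eq_zero hρ)).mono
    fun x hx => hx.1 (by rw [_root_.proj1_emb12]; exact hx.2)).choice
  have hyO : y =O[𝓝 0] fun x => x :=
    (IsBigO.of_bound C (hy.mono fun x hx => hx.2)).trans hO
  refine (((hb _ _ hρ'.prodWithFull).comp_tendsto (hyO.trans_tendsto tendsto_id)).trans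
    (hyO.norm_norm.pow k)).congr' ?_ .rfl
  filter_upwards [hy] with x hx
  simp only [Function.comp_apply, hx.1]

end KEquivalence

theorem statement7 (N₁ N₂ d k l : ℕ) (M₁ M₁' : Set (Cn N₁))
    (h₁ : IsGenericSubmanifold N₁ d M₁) (h₁' : IsGenericSubmanifold N₁ d M₁')
    (h0 : (0 : Cn N₁) ∈ M₁) (h0' : (0 : Cn N₁) ∈ M₁')
    (hnd : IsLNondegAt N₁ d M₁' 0 l) (hk : l + 1 < k)
    (H : Cn (N₁ + N₂) → Cn (N₁ + N₂))
    (hH : IsKEquivalence (N₁ + N₂) d (prodWithFull N₁ N₂ M₁)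
      (prodWithFull N₁ N₂ M₁') 0 0 k H) :
    -- (i)  ∂H¹/∂Z² (Z) = O(|Z|^{k-l-1})
    (∃ C ε : ℝ, 0 < ε ∧ ∀ Z : Cn (N₁ + N₂), ‖Z‖ < ε →
      ∀ (i : Fin N₁) (j : Fin N₂),
        ‖fderiv ℂ (fun w => H w (Fin.castAdd N₂ i)) Z (Pi.single (Fin.natAdd N₁ j) 1)‖ ≤
          C * ‖Z‖ ^ (k - l - 1)) ∧
    -- (ii)  Z¹ ↦ H¹(Z¹,0) is a k-equivalence between (M₁,0) and (M₁',0)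
    IsKEquivalence N₁ d M₁ M₁' 0 0 k (fun z => proj1 N₁ N₂ (H (emb12 N₁ N₂ z))) := by
  have hi := fun j => hH.isBigO_fderiv_proj1 h₁ h0 h0' hnd.1 hk j
  have hHa : AnalyticAt ℂ H 0 := hH.1
  refine ⟨?_, hH.proj1_emb12 h₁ h0 fun j => ?_⟩
  · have h1 : (fun Z => fun (j : Fin N₂) (i : Fin N₁) =>
        fderiv ℂ (fun w => H w (Fin.castAdd N₂ i)) Z (Pi.single (Fin.natAdd N₁ j) 1)) =O[𝓝 0]
        fun Z => ‖Z‖ ^ (k - l - 1) := by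
      refine isBigO_pi.2 fun j => (hi j).congr' ?_ .rfl
      filter_upwards [hHa.eventually_analyticAt] with Z hZ
      funext i
      rw [fderiv_proj1_comp hZ.differentiableAt, fderiv_apply_comp hZ.differentiableAt]
      rfl
    obtain ⟨C, ε, hε, hb⟩ := isBigO_norm_pow_iff.1 h1
    refine ⟨C, ε, hε, fun Z hZ i j => le_trans ?_ (hb Z hZ)⟩
    exact (norm_le_pi_norm (fun i : Fin N₁ => fderiv ℂ (fun w => H w (Fin.castAdd N₂ i)) Z
        (Pi.single (Fin.natAdd N₁ j) 1)) i).trans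
      (norm_le_pi_norm (fun (j : Fin N₂) (i : Fin N₁) =>
        fderiv ℂ (fun w => H w (Fin.castAdd N₂ i)) Z (Pi.single (Fin.natAdd N₁ j) 1)) j)
  · have h2 := (show (fun z => fderiv ℂ (fun w => proj1 N₁ N₂ (H w)) z
        (Pi.single (Fin.natAdd N₁ j) 1)) =O[𝓝 0] fun z => ‖z - 0‖ ^ (k - l - 1) by
      simpa using hi j).eq_zero_of_norm_pow (by omega)
    rwa [fderiv_proj1_comp hHa.differentiableAt] at h2
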